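/- arXiv:math/0602036 — 2 statements merged into one kernel-verified Lean document; each statement's English description precedes it below -/
import Mathlib

section
/- Let G be a subgroup of PL₊(I), n ≥ 1, and A an orbital of G. If G admits a tower of height n all of whose orbitals are contained in A, then the derived subgroup G' admits a tower of height n−1 all of whose orbitals are contained in A. -/
/-- The support of a map of the line: points it moves. -/
def Supp (f : ℝ → ℝ) : Set ℝ := {x | f x ≠ x}

/-- `A` is an orbital of `f`: a connected component of the support of `f`. -/
def IsOrbital (f : ℝ → ℝ) (A : Set ℝ) : Prop :=
  ∃ x ∈ Supp f, A = connectedComponentIn (Supp f) x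

/-- An orientation-preserving homeomorphism of `[0,1]`, encoded as a strictly
increasing bijection of `ℝ` fixing every point outside `(0,1)`. -/
def Homeo01 (f : Equiv.Perm ℝ) : Prop :=
  StrictMono f ∧ ∀ x ∉ Set.Ioo (0:ℝ) 1, f x = x

/-- `f` is affine in a neighbourhood of `x`. -/
def LocallyAffineAt (f : ℝ → ℝ) (x : ℝ) : Prop :=
  ∃ ε > 0, ∃ m b : ℝ, ∀ y : ℝ, |y - x| < ε → f y = m * y + b

/-- Piecewise linear with finitely many breakpoints. -/
def IsPL (f : ℝ → ℝ) : Prop := {x | ¬ LocallyAffineAt f x}.Finite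

/-- Membership in `PL₊(I)`. -/
def PLHomeo (f : Equiv.Perm ℝ) : Prop := Homeo01 f ∧ IsPL f

/-- Support of the action of a subgroup. -/
def GSupp (G : Subgroup (Equiv.Perm ℝ)) : Set ℝ := {x | ∃ g ∈ G, g x ≠ x}

/-- An orbital of a subgroup: a component of the support of its action. -/
def IsGroupOrbital (G : Subgroup (Equiv.Perm ℝ)) (A : Set ℝ) : Prop :=
  ∃ x ∈ GSupp G, A = connectedComponentIn (GSupp G) x

/-- `b` is a breakpoint of `f`: one-sided derivatives exist but differ. -/
def Breakpoint (f : ℝ → ℝ) (b : ℝ) : Prop :=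
  b ∈ Set.Ioo (0:ℝ) 1 ∧
  DifferentiableWithinAt ℝ f (Set.Iio b) b ∧
  DifferentiableWithinAt ℝ f (Set.Ioi b) b ∧
  derivWithin f (Set.Iio b) b ≠ derivWithin f (Set.Ioi b) b

/-- `G` admits a transition chain of length two. -/
def HasTransitionChain2 (G : Subgroup (Equiv.Perm ℝ)) : Prop :=
  ∃ g ∈ G, ∃ h ∈ G, ∃ a₁ b₁ a₂ b₂ : ℝ,
    IsOrbital g (Set.Ioo a₁ a₂) ∧ IsOrbital h (Set.Ioo b₁ b₂) ∧
    a₁ < b₁ ∧ b₁ < a₂ ∧ a₂ < b₂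

/-- A tower of the subgroup `G`: a set of signed orbitals `(A, g)` whose orbitals
form a chain under inclusion, with exactly one signature per orbital. -/
def IsTower (G : Subgroup (Equiv.Perm ℝ)) (T : Set (Set ℝ × Equiv.Perm ℝ)) : Prop :=
  (∀ p ∈ T, p.2 ∈ G ∧ IsOrbital p.2 p.1) ∧
  (∀ p ∈ T, ∀ q ∈ T, p.1 ⊆ q.1 ∨ q.1 ⊆ p.1) ∧
  (∀ p ∈ T, ∀ q ∈ T, p.1 = q.1 → p = q)

/-- The depth of `G` equals `n`: there is a tower of height `n` and every tower
is finite with height at most `n`. -/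
def DepthEq (G : Subgroup (Equiv.Perm ℝ)) (n : ℕ) : Prop :=
  (∃ T, IsTower G T ∧ T.Finite ∧ T.ncard = n) ∧
  ∀ T, IsTower G T → T.Finite ∧ T.ncard ≤ n

section DerivedTowers

open scoped commutatorElement

/-! ### Increasing bijections of the line -/

theorem PLHomeo.strictMono {f : Equiv.Perm ℝ} (hf : PLHomeo f) : StrictMono f := hf.1.1

theorem StrictMono.perm_continuous {f : Equiv.Perm ℝ} (hf : StrictMono f) : Continuous f :=
  hf.monotone.continuous_of_surjective f.surjective

theorem StrictMono.inv_lt_iff {f : Equiv.Perm ℝ} (hf : StrictMono f) {x y : ℝ} :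
    f⁻¹ x < y ↔ x < f y := by
  rw [← hf.lt_iff_lt (a := f⁻¹ x)]; simp

theorem StrictMono.lt_inv_iff {f : Equiv.Perm ℝ} (hf : StrictMono f) {x y : ℝ} :
    x < f⁻¹ y ↔ f x < y := by
  rw [← hf.lt_iff_lt (b := f⁻¹ y)]; simp

theorem StrictMono.isClosed_fixed {f : Equiv.Perm ℝ} (hf : StrictMono f) :
    IsClosed {z | f z = z} :=
  isClosed_eq hf.perm_continuous continuous_id

theorem StrictMono.apply_lt_iff_of_fixed {f : ℝ → ℝ} (hf : StrictMono f) {x p : ℝ}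
    (hp : f p = p) : f x < p ↔ x < p := by
  conv_lhs => rw [← hp, hf.lt_iff_lt]

theorem StrictMono.lt_apply_iff_of_fixed {f : ℝ → ℝ} (hf : StrictMono f) {x p : ℝ}
    (hp : f p = p) : p < f x ↔ p < x := by
  conv_lhs => rw [← hp, hf.lt_iff_lt]

theorem inv_apply_eq_self {f : Equiv.Perm ℝ} {x : ℝ} (h : f x = x) : f⁻¹ x = x := by
  rw [Equiv.Perm.inv_eq_iff_eq, h]

theorem conj_apply_eq_self_iff {v f : Equiv.Perm ℝ} {z : ℝ} :
    (v * f * v⁻¹) z = z ↔ f (v⁻¹ z) = v⁻¹ z := by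
  simp only [Equiv.Perm.mul_apply]
  rw [eq_comm (b := v⁻¹ z), Equiv.Perm.inv_eq_iff_eq, eq_comm]

theorem apply_eq_self_of_mem_closure {S : Set (Equiv.Perm ℝ)} {z : ℝ}
    (hS : ∀ g ∈ S, g z = z) {v : Equiv.Perm ℝ} (hv : v ∈ Subgroup.closure S) : v z = z := by
  have h : Subgroup.closure S ≤ MulAction.stabilizer (Equiv.Perm ℝ) z :=
    (Subgroup.closure_le _).2 fun g hg => hS g hg
  exact h hv

theorem IsClosed.exists_last_below {F : Set ℝ} (hF : IsClosed F) {p z₀ : ℝ} (hp : p ∉ F)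
    (hz₀ : z₀ ∈ F) (hlt : z₀ < p) :
    ∃ r ∈ F, z₀ ≤ r ∧ r < p ∧ ∀ z, r < z → z ≤ p → z ∉ F := by
  have hbdd : BddAbove (F ∩ Set.Iic p) := ⟨p, fun z hz => hz.2⟩
  have hmem := (hF.inter isClosed_Iic).csSup_mem ⟨z₀, hz₀, hlt.le⟩ hbdd
  refine ⟨_, hmem.1, le_csSup hbdd ⟨hz₀, hlt.le⟩, lt_of_le_of_ne hmem.2 ?_, ?_⟩
  · intro h
    exact hp (h ▸ hmem.1)
  · intro z hz hzp hzF
    exact absurd (le_csSup hbdd ⟨hzF, hzp⟩) (not_le.2 hz)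

theorem IsClosed.exists_first_above {F : Set ℝ} (hF : IsClosed F) {p z₀ : ℝ} (hp : p ∉ F)
    (hz₀ : z₀ ∈ F) (hlt : p < z₀) :
    ∃ r ∈ F, r ≤ z₀ ∧ p < r ∧ ∀ z, p ≤ z → z < r → z ∉ F := by
  have hbdd : BddBelow (F ∩ Set.Ici p) := ⟨p, fun z hz => hz.2⟩
  have hmem := (hF.inter isClosed_Ici).csInf_mem ⟨z₀, hz₀, hlt.le⟩ hbdd
  refine ⟨_, hmem.1, csInf_le hbdd ⟨hz₀, hlt.le⟩, lt_of_le_of_ne hmem.2 ?_, ?_⟩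
  · intro h
    exact hp (h ▸ hmem.1)
  · intro z hpz hz hzF
    exact absurd (csInf_le hbdd ⟨hzF, hpz⟩) (not_le.2 hz)

theorem exists_lt_apply_of_moved {H : Subgroup (Equiv.Perm ℝ)} (hH : ∀ v ∈ H, StrictMono v)
    {α β p q : ℝ} (hmove : ∀ z, α < z → z < β → ∃ v ∈ H, v z ≠ z) (hp : α < p) (hq : q < β) :
    ∃ v ∈ H, q < v p := by
  by_contra! hcon
  set S : Set ℝ := {y | ∃ v ∈ H, v p = y}
  have hpS : p ∈ S := ⟨1, H.one_mem, rfl⟩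
  have hup : q ∈ upperBounds S := by
    rintro y ⟨v, hv, rfl⟩
    exact hcon v hv
  have hbdd : BddAbove S := ⟨q, hup⟩
  have h1 : p ≤ sSup S := le_csSup hbdd hpS
  have h2 : sSup S ≤ q := csSup_le ⟨p, hpS⟩ hup
  obtain ⟨t, ht, htσ⟩ : ∃ t ∈ H, sSup S < t (sSup S) := by
    obtain ⟨v, hv, hne⟩ := hmove (sSup S) (by linarith) (by linarith)
    rcases lt_or_gt_of_ne hne with h | h
    · exact ⟨v⁻¹, H.inv_mem hv, (hH v hv).lt_inv_iff.2 h⟩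
    · exact ⟨v, hv, h⟩
  obtain ⟨_, ⟨v, hv, rfl⟩, hlt⟩ :=
    exists_lt_of_lt_csSup ⟨p, hpS⟩ ((hH t ht).inv_lt_iff.2 htσ)
  rw [(hH t ht).inv_lt_iff] at hlt
  exact absurd (le_csSup hbdd ⟨t * v, H.mul_mem ht hv, rfl⟩) (not_le.2 hlt)

/-! ### Germs of piecewise linear maps -/

theorem LocallyAffineAt.analyticAt {f : ℝ → ℝ} {x : ℝ} (h : LocallyAffineAt f x) :
    AnalyticAt ℝ f x := by
  obtain ⟨ε, hε, m, b, hf⟩ := h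
  have ha : AnalyticAt ℝ (fun y : ℝ => m * y + b) x := by fun_prop
  refine ha.congr ?_
  filter_upwards [Metric.ball_mem_nhds x hε] with y hy
  exact (hf y (by simpa [Real.dist_eq] using hy)).symm

theorem exists_eqOn_affine {f : ℝ → ℝ} {s t : ℝ} (hst : s < t)
    (h : ∀ y ∈ Set.Ioo s t, LocallyAffineAt f y) :
    ∃ m b : ℝ, Set.EqOn f (fun y => m * y + b) (Set.Ioo s t) := by
  obtain ⟨y₀, hy₀⟩ := Set.nonempty_Ioo.2 hst
  obtain ⟨ε, hε, m, b, hf⟩ := h y₀ hy₀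
  refine ⟨m, b, AnalyticOnNhd.eqOn_of_preconnected_of_eventuallyEq
    (fun y hy => (h y hy).analyticAt) (fun y _ => by fun_prop) isPreconnected_Ioo hy₀ ?_⟩
  filter_upwards [Metric.ball_mem_nhds y₀ hε] with y hy
  exact hf y (by simpa [Real.dist_eq] using hy)

theorem IsPL.exists_punctured {f : ℝ → ℝ} (hf : IsPL f) (p : ℝ) :
    ∃ ε > 0, ∀ y, |y - p| < ε → y ≠ p → LocallyAffineAt f y := by
  have hc : IsClosed ({x | ¬ LocallyAffineAt f x} \ {p}) :=
    (Set.Finite.subset hf Set.sdiff_subset).isClosed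
  obtain ⟨ε, hε, hball⟩ := Metric.mem_nhds_iff.1 (hc.compl_mem_nhds (x := p) (by simp))
  refine ⟨ε, hε, fun y hy hne => ?_⟩
  by_contra hcon
  exact hball (by simpa [Real.dist_eq] using hy : y ∈ Metric.ball p ε) ⟨hcon, hne⟩

theorem PLHomeo.exists_left_germ {f : Equiv.Perm ℝ} (hf : PLHomeo f) {p : ℝ} (hp : f p = p) :
    ∃ c < p, ∃ m : ℝ, ∀ y, c ≤ y → y ≤ p → f y = p + m * (y - p) := by
  obtain ⟨ε, hε, hloc⟩ := hf.2.exists_punctured p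
  obtain ⟨m, b, hmb⟩ := exists_eqOn_affine (s := p - ε) (t := p) (by linarith)
    fun y hy => hloc y (by rw [abs_lt]; constructor <;> linarith [hy.1, hy.2]) hy.2.ne
  have hcl := hmb.closure hf.strictMono.perm_continuous (by fun_prop)
  rw [closure_Ioo (by linarith)] at hcl
  have hpp : f p = m * p + b := hcl ⟨by linarith, le_rfl⟩
  refine ⟨p - ε, by linarith, m, fun y hy hyp => ?_⟩
  have := hcl ⟨hy, hyp⟩
  simp only at this
  rw [this]
  linarith

theorem PLHomeo.exists_right_germ {f : Equiv.Perm ℝ} (hf : PLHomeo f) {p : ℝ} (hp : f p = p) :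
    ∃ c > p, ∃ m : ℝ, ∀ y, p ≤ y → y ≤ c → f y = p + m * (y - p) := by
  obtain ⟨ε, hε, hloc⟩ := hf.2.exists_punctured p
  obtain ⟨m, b, hmb⟩ := exists_eqOn_affine (s := p) (t := p + ε) (by linarith)
    fun y hy => hloc y (by rw [abs_lt]; constructor <;> linarith [hy.1, hy.2]) hy.1.ne'
  have hcl := hmb.closure hf.strictMono.perm_continuous (by fun_prop)
  rw [closure_Ioo (by linarith)] at hcl
  have hpp : f p = m * p + b := hcl ⟨le_rfl, by linarith⟩
  refine ⟨p + ε, by linarith, m, fun y hy hyp => ?_⟩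
  have := hcl ⟨hy, hyp⟩
  simp only at this
  rw [this]
  linarith

theorem PLHomeo.left_dichotomy {f : Equiv.Perm ℝ} (hf : PLHomeo f) {p : ℝ} (hp : f p = p) :
    (∃ c < p, ∀ y, c ≤ y → y ≤ p → f y = y) ∨ (∃ c < p, ∀ y, c ≤ y → y < p → f y ≠ y) := by
  obtain ⟨c, hc, m, hm⟩ := hf.exists_left_germ hp
  rcases eq_or_ne m 1 with rfl | hne
  · exact Or.inl ⟨c, hc, fun y h1 h2 => by rw [hm y h1 h2]; ring⟩
  · refine Or.inr ⟨c, hc, fun y h1 h2 heq => ?_⟩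
    have h0 : (m - 1) * (y - p) = 0 := by linarith [hm y h1 h2.le]
    rcases mul_eq_zero.1 h0 with h | h
    · exact hne (by linarith)
    · linarith

theorem PLHomeo.right_dichotomy {f : Equiv.Perm ℝ} (hf : PLHomeo f) {p : ℝ} (hp : f p = p) :
    (∃ c > p, ∀ y, p ≤ y → y ≤ c → f y = y) ∨ (∃ c > p, ∀ y, p < y → y ≤ c → f y ≠ y) := by
  obtain ⟨c, hc, m, hm⟩ := hf.exists_right_germ hp
  rcases eq_or_ne m 1 with rfl | hne
  · exact Or.inl ⟨c, hc, fun y h1 h2 => by rw [hm y h1 h2]; ring⟩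
  · refine Or.inr ⟨c, hc, fun y h1 h2 heq => ?_⟩
    have h0 : (m - 1) * (y - p) = 0 := by linarith [hm y h1.le h2]
    rcases mul_eq_zero.1 h0 with h | h
    · exact hne (by linarith)
    · linarith

theorem commutator_apply_eq_self {g h : Equiv.Perm ℝ} {z : ℝ}
    (H : g (h (g⁻¹ (h⁻¹ z))) = h (g (g⁻¹ (h⁻¹ z)))) : ⁅g, h⁆ z = z := by
  simpa [commutatorElement_def] using H

theorem PLHomeo.commutator_left_trivial {g h : Equiv.Perm ℝ} (hg : PLHomeo g) (hh : PLHomeo h)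
    {p : ℝ} (hgp : g p = p) (hhp : h p = p) :
    ∃ c < p, ∀ y, c ≤ y → y ≤ p → ⁅g, h⁆ y = y := by
  obtain ⟨c₁, hc₁, m₁, hm₁⟩ := hg.exists_left_germ hgp
  obtain ⟨c₂, hc₂, m₂, hm₂⟩ := hh.exists_left_germ hhp
  have sg := hg.strictMono
  have sh := hh.strictMono
  have key : ∀ᶠ y in nhds p, c₁ < y ∧ c₂ < y ∧ c₁ < h y ∧ c₂ < g y := by
    refine (eventually_gt_nhds hc₁).and ((eventually_gt_nhds hc₂).and (.and ?_ ?_))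
    · exact sh.perm_continuous.tendsto p (by rw [hhp]; exact eventually_gt_nhds hc₁)
    · exact sg.perm_continuous.tendsto p (by rw [hgp]; exact eventually_gt_nhds hc₂)
  obtain ⟨ε, hε, hball⟩ := Metric.eventually_nhds_iff.1 key
  have hlt : h (g (p - ε / 2)) < p := by
    have := sh (sg (by linarith : p - ε / 2 < p))
    rwa [hgp, hhp] at this
  refine ⟨_, hlt, fun y hy hyp => commutator_apply_eq_self ?_⟩
  set x := g⁻¹ (h⁻¹ y)
  have hxy : h (g x) = y := by simp [x]
  have hx1 : p - ε / 2 ≤ x := by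
    rwa [← hxy, sh.le_iff_le, sg.le_iff_le] at hy
  have hx2 : x ≤ p := by
    rwa [← hxy, ← not_lt, sh.lt_apply_iff_of_fixed hhp, sg.lt_apply_iff_of_fixed hgp,
      not_lt] at hyp
  obtain ⟨k1, k2, k3, k4⟩ := hball (y := x) (by rw [Real.dist_eq, abs_lt]; constructor <;> linarith)
  have e1 : g x ≤ p := hgp ▸ sg.monotone hx2
  have e2 : h x ≤ p := hhp ▸ sh.monotone hx2
  rw [hm₁ _ k3.le e2, hm₂ _ k4.le e1, hm₁ _ k1.le hx2, hm₂ _ k2.le hx2]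
  ring

theorem PLHomeo.commutator_right_trivial {g h : Equiv.Perm ℝ} (hg : PLHomeo g) (hh : PLHomeo h)
    {p : ℝ} (hgp : g p = p) (hhp : h p = p) :
    ∃ c > p, ∀ y, p ≤ y → y ≤ c → ⁅g, h⁆ y = y := by
  obtain ⟨c₁, hc₁, m₁, hm₁⟩ := hg.exists_right_germ hgp
  obtain ⟨c₂, hc₂, m₂, hm₂⟩ := hh.exists_right_germ hhp
  have sg := hg.strictMono
  have sh := hh.strictMono
  have key : ∀ᶠ y in nhds p, y < c₁ ∧ y < c₂ ∧ h y < c₁ ∧ g y < c₂ := by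
    refine (eventually_lt_nhds hc₁).and ((eventually_lt_nhds hc₂).and (.and ?_ ?_))
    · exact sh.perm_continuous.tendsto p (by rw [hhp]; exact eventually_lt_nhds hc₁)
    · exact sg.perm_continuous.tendsto p (by rw [hgp]; exact eventually_lt_nhds hc₂)
  obtain ⟨ε, hε, hball⟩ := Metric.eventually_nhds_iff.1 key
  have hlt : p < h (g (p + ε / 2)) := by
    have := sh (sg (by linarith : p < p + ε / 2))
    rwa [hgp, hhp] at this
  refine ⟨_, hlt, fun y hyp hy => commutator_apply_eq_self ?_⟩
  set x := g⁻¹ (h⁻¹ y)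
  have hxy : h (g x) = y := by simp [x]
  have hx1 : x ≤ p + ε / 2 := by
    rwa [← hxy, sh.le_iff_le, sg.le_iff_le] at hy
  have hx2 : p ≤ x := by
    rwa [← hxy, ← not_lt, sh.apply_lt_iff_of_fixed hhp, sg.apply_lt_iff_of_fixed hgp,
      not_lt] at hyp
  obtain ⟨k1, k2, k3, k4⟩ := hball (y := x) (by rw [Real.dist_eq, abs_lt]; constructor <;> linarith)
  have e1 : p ≤ g x := hgp ▸ sg.monotone hx2
  have e2 : p ≤ h x := hhp ▸ sh.monotone hx2
  rw [hm₁ _ e2 k3.le, hm₂ _ e1 k4.le, hm₁ _ hx2 k1.le, hm₂ _ hx2 k2.le]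
  ring

/-! ### Orbitals as intervals -/

/-- `f` fixes the endpoints of the interval `(a, b)` and moves every point inside it. -/
structure MovesOn (f : Equiv.Perm ℝ) (a b : ℝ) : Prop where
  lt : a < b
  left : f a = a
  right : f b = b
  ne : ∀ z, a < z → z < b → f z ≠ z

theorem StrictMono.exists_movesOn {f : Equiv.Perm ℝ} (hf : StrictMono f) {z₀ p z₁ : ℝ}
    (h₀ : z₀ < p) (h₁ : p < z₁) (hz₀ : f z₀ = z₀) (hz₁ : f z₁ = z₁) (hp : f p ≠ p) :
    ∃ x y, z₀ ≤ x ∧ x < p ∧ p < y ∧ y ≤ z₁ ∧ MovesOn f x y := by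
  obtain ⟨x, hx, hzx, hxp, hx'⟩ := hf.isClosed_fixed.exists_last_below (p := p) hp hz₀ h₀
  obtain ⟨y, hy, hyz, hpy, hy'⟩ := hf.isClosed_fixed.exists_first_above (p := p) hp hz₁ h₁
  refine ⟨x, y, hzx, hxp, hpy, hyz, hxp.trans hpy, hx, hy, fun z h1 h2 => ?_⟩
  rcases le_total z p with h | h
  · exact hx' z h1 h
  · exact hy' z h h2

theorem MovesOn.connectedComponentIn_eq {f : Equiv.Perm ℝ} {a b x : ℝ} (h : MovesOn f a b)
    (hx : x ∈ Set.Ioo a b) : connectedComponentIn (Supp f) x = Set.Ioo a b := by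
  have hsub : Set.Ioo a b ⊆ Supp f := fun z hz => h.ne z hz.1 hz.2
  refine Set.Subset.antisymm (fun y hy => ?_)
    (isPreconnected_Ioo.subset_connectedComponentIn hx hsub)
  have hord : (connectedComponentIn (Supp f) x).OrdConnected :=
    isPreconnected_connectedComponentIn.ordConnected
  have hmem : x ∈ connectedComponentIn (Supp f) x := mem_connectedComponentIn (hsub hx)
  have hfix : ∀ z, f z = z → z ∉ connectedComponentIn (Supp f) x := fun z hz hmz =>
    connectedComponentIn_subset _ _ hmz hz
  constructor
  · by_contra! hya
    exact hfix a h.left (hord.out hy hmem ⟨hya, hx.1.le⟩)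
  · by_contra! hya
    exact hfix b h.right (hord.out hmem hy ⟨hx.2.le, hya⟩)

theorem MovesOn.isOrbital {f : Equiv.Perm ℝ} {a b : ℝ} (h : MovesOn f a b) :
    IsOrbital f (Set.Ioo a b) := by
  obtain ⟨x, hx⟩ := Set.nonempty_Ioo.2 h.lt
  exact ⟨x, h.ne x hx.1 hx.2, (h.connectedComponentIn_eq hx).symm⟩

theorem PLHomeo.apply_zero {f : Equiv.Perm ℝ} (hf : PLHomeo f) : f 0 = 0 :=
  hf.1.2 0 (by simp)

theorem PLHomeo.apply_one {f : Equiv.Perm ℝ} (hf : PLHomeo f) : f 1 = 1 :=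
  hf.1.2 1 (by simp)

theorem PLHomeo.mem_Ioo {f : Equiv.Perm ℝ} (hf : PLHomeo f) {x : ℝ} (hx : f x ≠ x) :
    x ∈ Set.Ioo (0 : ℝ) 1 := by
  by_contra h
  exact hx (hf.1.2 x h)

theorem IsOrbital.exists_movesOn {f : Equiv.Perm ℝ} {B : Set ℝ} (hf : PLHomeo f)
    (hB : IsOrbital f B) : ∃ a b, B = Set.Ioo a b ∧ MovesOn f a b := by
  obtain ⟨x, hx, rfl⟩ := hB
  have h01 := hf.mem_Ioo hx
  obtain ⟨a, b, -, ha, hb, -, h⟩ :=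
    hf.strictMono.exists_movesOn h01.1 h01.2 hf.apply_zero hf.apply_one hx
  exact ⟨a, b, h.connectedComponentIn_eq ⟨ha, hb⟩, h⟩

theorem IsGroupOrbital.subset_of_inter_nonempty {G : Subgroup (Equiv.Perm ℝ)} {A S : Set ℝ}
    (hA : IsGroupOrbital G A) (hS : IsPreconnected S) (hsub : S ⊆ GSupp G)
    (hne : (S ∩ A).Nonempty) : S ⊆ A := by
  obtain ⟨x, hx, rfl⟩ := hA
  obtain ⟨z, hzS, hzA⟩ := hne
  rw [connectedComponentIn_eq hzA]
  exact hS.subset_connectedComponentIn hzS hsub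

theorem MovesOn.conj {f : Equiv.Perm ℝ} {a b : ℝ} (h : MovesOn f a b) {v : Equiv.Perm ℝ}
    (hv : StrictMono v) : MovesOn (v * f * v⁻¹) (v a) (v b) where
  lt := hv h.lt
  left := by simp [h.left]
  right := by simp [h.right]
  ne z hz₁ hz₂ := fun heq =>
    h.ne _ (hv.lt_inv_iff.2 hz₁) (hv.inv_lt_iff.2 hz₂) (conj_apply_eq_self_iff.1 heq)

theorem MovesOn.inv {f : Equiv.Perm ℝ} {a b : ℝ} (h : MovesOn f a b) : MovesOn f⁻¹ a b where
  lt := h.lt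
  left := inv_apply_eq_self h.left
  right := inv_apply_eq_self h.right
  ne z hz₁ hz₂ := fun heq => h.ne z hz₁ hz₂ (by simpa using inv_apply_eq_self heq)

theorem MovesOn.exists_lt_apply {f : Equiv.Perm ℝ} {a b p q : ℝ} (h : MovesOn f a b)
    (hf : ∀ v ∈ Subgroup.closure {f}, StrictMono v) (hp : a < p) (hq : q < b) :
    ∃ v ∈ Subgroup.closure {f}, q < v p :=
  exists_lt_apply_of_moved hf
    (fun z h1 h2 => ⟨f, Subgroup.subset_closure rfl, h.ne z h1 h2⟩) hp hq

theorem exists_movesOn_ending_at {g h : Equiv.Perm ℝ} (hg : PLHomeo g) (hh : PLHomeo h)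
    {α β : ℝ} (hαβ : α < β) (hgβ : g β = β) (hhβ : h β = β)
    (hmove : ∀ z, α < z → z < β → g z ≠ z ∨ h z ≠ z)
    (hgfix : ∃ z, α < z ∧ z < β ∧ g z = z) (hhfix : ∃ z, α < z ∧ z < β ∧ h z = z) :
    ∃ f ∈ ({g, h} : Set (Equiv.Perm ℝ)), ∃ r, α < r ∧ MovesOn f r β := by
  have key : ∀ f : Equiv.Perm ℝ, PLHomeo f → f β = β → (∃ z, α < z ∧ z < β ∧ f z = z) →
      (∃ c < β, ∀ y, c ≤ y → y < β → f y ≠ y) → ∃ r, α < r ∧ MovesOn f r β := by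
    rintro f hf hfβ ⟨z, hαz, hzβ, hfz⟩ ⟨c, hc, hmv⟩
    have hzc : z < c := by
      by_contra! hcon
      exact hmv z hcon hzβ hfz
    obtain ⟨r, hr, hzr, hrc, hr'⟩ :=
      hf.strictMono.isClosed_fixed.exists_last_below (p := c) (hmv c le_rfl hc) hfz hzc
    refine ⟨r, hαz.trans_le hzr, hrc.trans hc, hr, hfβ, fun y h1 h2 => ?_⟩
    rcases le_total y c with h | h
    · exact hr' y h1 h
    · exact hmv y h h2
  rcases hg.left_dichotomy hgβ with ⟨c, hc, hcf⟩ | hgm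
  · rcases hh.left_dichotomy hhβ with ⟨d, hd, hdf⟩ | hhm
    · obtain ⟨z, hz, hzβ⟩ := exists_between (max_lt hαβ (max_lt hc hd))
      simp only [max_lt_iff] at hz
      rcases hmove z hz.1 hzβ with h | h
      · exact absurd (hcf z hz.2.1.le hzβ.le) h
      · exact absurd (hdf z hz.2.2.le hzβ.le) h
    · exact ⟨h, by simp, key h hh hhβ hhfix hhm⟩
  · exact ⟨g, by simp, key g hg hgβ hgfix hgm⟩

theorem exists_movesOn_starting_at {g h : Equiv.Perm ℝ} (hg : PLHomeo g) (hh : PLHomeo h)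
    {α β : ℝ} (hαβ : α < β) (hgα : g α = α) (hhα : h α = α)
    (hmove : ∀ z, α < z → z < β → g z ≠ z ∨ h z ≠ z)
    (hgfix : ∃ z, α < z ∧ z < β ∧ g z = z) (hhfix : ∃ z, α < z ∧ z < β ∧ h z = z) :
    ∃ f ∈ ({g, h} : Set (Equiv.Perm ℝ)), ∃ s, s < β ∧ MovesOn f α s := by
  have key : ∀ f : Equiv.Perm ℝ, PLHomeo f → f α = α → (∃ z, α < z ∧ z < β ∧ f z = z) →
      (∃ c > α, ∀ y, α < y → y ≤ c → f y ≠ y) → ∃ s, s < β ∧ MovesOn f α s := by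
    rintro f hf hfα ⟨z, hαz, hzβ, hfz⟩ ⟨c, hc, hmv⟩
    have hzc : c < z := by
      by_contra! hcon
      exact hmv z hαz hcon hfz
    obtain ⟨s, hs, hsz, hcs, hs'⟩ :=
      hf.strictMono.isClosed_fixed.exists_first_above (p := c) (hmv c hc le_rfl) hfz hzc
    refine ⟨s, hsz.trans_lt hzβ, hc.trans hcs, hfα, hs, fun y h1 h2 => ?_⟩
    rcases le_total y c with h | h
    · exact hmv y h1 h
    · exact hs' y h h2
  rcases hg.right_dichotomy hgα with ⟨c, hc, hcf⟩ | hgm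
  · rcases hh.right_dichotomy hhα with ⟨d, hd, hdf⟩ | hhm
    · obtain ⟨z, hαz, hz⟩ := exists_between (lt_min hαβ (lt_min hc hd))
      simp only [lt_min_iff] at hz
      rcases hmove z hαz hz.1 with h | h
      · exact absurd (hcf z hαz.le hz.2.1.le) h
      · exact absurd (hdf z hαz.le hz.2.2.le) h
    · exact ⟨h, by simp, key h hh hhα hhfix hhm⟩
  · exact ⟨g, by simp, key g hg hgα hgfix hgm⟩

/-! ### Unbounded towers in the derived subgroup -/

theorem commutator_self_le (G : Subgroup (Equiv.Perm ℝ)) : ⁅G, G⁆ ≤ G :=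
  Subgroup.commutator_le.2 fun _ hg _ hh =>
    G.mul_mem (G.mul_mem (G.mul_mem hg hh) (G.inv_mem hg)) (G.inv_mem hh)

theorem conj_mem_commutator {G : Subgroup (Equiv.Perm ℝ)} {w v : Equiv.Perm ℝ}
    (hw : w ∈ ⁅G, G⁆) (hv : v ∈ G) : v * w * v⁻¹ ∈ ⁅G, G⁆ := by
  have h := (⁅G, G⁆).mul_mem
    (Subgroup.commutator_mem_commutator hv (commutator_self_le G hw)) hw
  simpa [commutatorElement_def, mul_assoc] using h

/-- Two elements moving overlapping initial and final parts of `(α, β)` and fixing `α` and `β`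
yield an orbital of the derived subgroup that some element of the group strictly expands. -/
theorem exists_expanded_orbital {G : Subgroup (Equiv.Perm ℝ)} (hG : ∀ g ∈ G, PLHomeo g)
    {g h : Equiv.Perm ℝ} (hg : g ∈ G) (hh : h ∈ G) {α β r s : ℝ} (hrs : r < s)
    (hgs : MovesOn g α s) (hhr : MovesOn h r β) (hgβ : g β = β) (hhα : h α = α)
    (hαr : α < r) (hsβ : s < β) :
    ∃ w ∈ ⁅G, G⁆, ∃ u ∈ G, ∃ x y, MovesOn w x y ∧ x < s ∧ s < y ∧ u x < x ∧ y < u y := by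
  wlog hdir : h⁻¹ s < s generalizing h
  · refine this (G.inv_mem hh) hhr.inv (inv_apply_eq_self hhα) ?_
    have hmono := (hG h hh).strictMono
    rw [inv_inv]
    have hne := hhr.ne s hrs hsβ
    rw [hmono.inv_lt_iff, not_lt] at hdir
    exact lt_of_le_of_ne hdir hne
  have sg := (hG g hg).strictMono
  have sh := (hG h hh).strictMono
  have shr : r < h⁻¹ s := by rwa [sh.lt_inv_iff, hhr.left]
  set w : Equiv.Perm ℝ := ⁅h, g⁆
  have hw : w ∈ ⁅G, G⁆ := Subgroup.commutator_mem_commutator hh hg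
  have hws : w s ≠ s := by
    intro heq
    have h1 : h (g (h⁻¹ s)) = s := by
      simpa only [w, commutatorElement_def, Equiv.Perm.mul_apply, inv_apply_eq_self hgs.right]
        using heq
    refine hgs.ne (h⁻¹ s) (hαr.trans shr) hdir ?_
    conv_rhs => rw [← h1]
    simp
  obtain ⟨c, hc, hcw⟩ := (hG h hh).commutator_right_trivial (hG g hg) hhα hgs.left
  obtain ⟨d, hd, hdw⟩ := (hG h hh).commutator_left_trivial (hG g hg) hhr.right hgβ
  obtain ⟨z₀, hz₀α, hz₀⟩ := exists_between (lt_min hc hgs.lt)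
  obtain ⟨z₁, hz₁, hz₁β⟩ := exists_between (max_lt hd hsβ)
  rw [lt_min_iff] at hz₀
  rw [max_lt_iff] at hz₁
  obtain ⟨x, y, hx0, hxs, hsy, hy1, hm⟩ :=
    (hG w (commutator_self_le G hw)).strictMono.exists_movesOn hz₀.2 hz₁.2
      (hcw z₀ hz₀α.le hz₀.1.le) (hdw z₁ hz₁.1.le hz₁β.le) hws
  have hαx : α < x := hz₀α.trans_le hx0
  have hyβ : y < β := hy1.trans_lt hz₁β
  have hgG : Subgroup.closure {g} ≤ G := (Subgroup.closure_le G).2 (by simpa using hg)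
  have hhG : Subgroup.closure {h} ≤ G := (Subgroup.closure_le G).2 (by simpa using hh)
  have hfix : ∀ (f : Equiv.Perm ℝ) (z : ℝ), f z = z → ∀ v ∈ Subgroup.closure {f}, v z = z :=
    fun f z hz v hv => apply_eq_self_of_mem_closure (by simpa using hz) hv
  obtain ⟨v₀, hv₀, hv₀r⟩ :=
    hgs.exists_lt_apply (fun v hv => (hG v (hgG hv)).strictMono) hαr hxs
  have sv₀ := (hG _ (hgG hv₀)).strictMono
  have sv₀' := (hG _ (G.inv_mem (hgG hv₀))).strictMono
  have hm' := hm.conj sv₀'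
  have hx' : v₀⁻¹ x < r := sv₀.inv_lt_iff.2 hv₀r
  have hαx' : α < v₀⁻¹ x := by rwa [sv₀.lt_inv_iff, hfix g α hgs.left v₀ hv₀]
  have hsy' : s < v₀⁻¹ y := by rwa [sv₀.lt_inv_iff, hfix g s hgs.right v₀ hv₀]
  have hyβ' : v₀⁻¹ y < β := by rwa [sv₀.inv_lt_iff, hfix g β hgβ v₀ hv₀]
  obtain ⟨v, hv, hvr⟩ :=
    hgs.exists_lt_apply (fun v hv => (hG v (hgG hv)).strictMono) hαx' hrs
  have sv := (hG _ (hgG hv)).strictMono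
  have hvy : v (v₀⁻¹ y) < β := (sv.apply_lt_iff_of_fixed (hfix g β hgβ v hv)).2 hyβ'
  obtain ⟨t, ht, hty⟩ :=
    hhr.exists_lt_apply (fun v hv => (hG v (hhG hv)).strictMono) (hrs.trans hsy') hvy
  have st := (hG _ (hhG ht)).strictMono
  refine ⟨_, conj_mem_commutator hw (G.inv_mem (hgG hv₀)), v⁻¹ * t,
    G.mul_mem (G.inv_mem (hgG hv)) (hhG ht), _, _, hm', hx'.trans hrs, hsy', ?_, ?_⟩
  · rw [Equiv.Perm.mul_apply, sv.inv_lt_iff]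
    exact ((st.apply_lt_iff_of_fixed (hfix h r hhr.left t ht)).2 hx').trans hvr
  · rwa [Equiv.Perm.mul_apply, sv.lt_inv_iff]

/-- `H` has towers of every finite height with all orbitals contained in `A`. -/
def HasTallTowers (H : Subgroup (Equiv.Perm ℝ)) (A : Set ℝ) : Prop :=
  ∀ N : ℕ, ∃ T, IsTower H T ∧ T.Finite ∧ T.ncard = N ∧ ∀ p ∈ T, p.1 ⊆ A

theorem hasTallTowers_of_expanded_orbital {G : Subgroup (Equiv.Perm ℝ)}
    (hG : ∀ g ∈ G, PLHomeo g) {A : Set ℝ} (hA : IsGroupOrbital G A) {w u : Equiv.Perm ℝ}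
    (hw : w ∈ ⁅G, G⁆) (hu : u ∈ G) {x y s : ℝ} (hm : MovesOn w x y) (hs : s ∈ Set.Ioo x y)
    (hsA : s ∈ A) (hux : u x < x) (huy : y < u y) : HasTallTowers ⁅G, G⁆ A := by
  have su : ∀ k : ℕ, StrictMono (u ^ k : Equiv.Perm ℝ) :=
    fun k => (hG _ (G.pow_mem hu k)).strictMono
  have hanti : StrictAnti fun k : ℕ => (u ^ k : Equiv.Perm ℝ) x := by
    refine strictAnti_nat_of_succ_lt fun k => ?_
    rw [pow_succ, Equiv.Perm.mul_apply]
    exact su k hux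
  have hmono : StrictMono fun k : ℕ => (u ^ k : Equiv.Perm ℝ) y := by
    refine strictMono_nat_of_lt_succ fun k => ?_
    rw [pow_succ, Equiv.Perm.mul_apply]
    exact su k huy
  set F : ℕ → Set ℝ × Equiv.Perm ℝ := fun k =>
    (Set.Ioo ((u ^ k : Equiv.Perm ℝ) x) ((u ^ k : Equiv.Perm ℝ) y), u ^ k * w * (u ^ k)⁻¹)
  have hFmem : ∀ k, (F k).2 ∈ ⁅G, G⁆ := fun k => conj_mem_commutator hw (G.pow_mem hu k)
  have hFmov : ∀ k, MovesOn (F k).2 ((u ^ k : Equiv.Perm ℝ) x) ((u ^ k : Equiv.Perm ℝ) y) :=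
    fun k => hm.conj (su k)
  have hsub : ∀ {i j}, i ≤ j → (F i).1 ⊆ (F j).1 := fun hij =>
    Set.Ioo_subset_Ioo (hanti.antitone hij) (hmono.monotone hij)
  have hinj : Function.Injective fun k => (F k).1 := by
    intro i j hij
    have h := congrArg sInf hij
    exact hanti.injective (by simpa only [F, csInf_Ioo (hFmov _).lt] using h)
  have hFA : ∀ k, (F k).1 ⊆ A := by
    intro k
    refine hA.subset_of_inter_nonempty isPreconnected_Ioo ?_ ⟨s, ?_, hsA⟩
    · intro z hz
      exact ⟨_, commutator_self_le G (hFmem k), (hFmov k).ne z hz.1 hz.2⟩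
    · exact hsub (Nat.zero_le k) (by simpa [F] using hs)
  intro N
  refine ⟨F '' Set.Iio N, ⟨?_, ?_, ?_⟩, (Set.finite_Iio N).image F, ?_, ?_⟩
  · rintro _ ⟨k, -, rfl⟩
    exact ⟨hFmem k, (hFmov k).isOrbital⟩
  · rintro _ ⟨i, -, rfl⟩ _ ⟨j, -, rfl⟩
    exact (le_total i j).imp hsub hsub
  · rintro _ ⟨i, -, rfl⟩ _ ⟨j, -, rfl⟩ hij
    exact congrArg F (hinj hij)
  · rw [Set.InjOn.ncard_image fun i _ j _ hij => hinj (congrArg Prod.fst hij)]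
    simp [Set.ncard_eq_toFinset_card']
  · rintro _ ⟨k, -, rfl⟩
    exact hFA k

theorem hasTallTowers_of_no_common_fixed {G : Subgroup (Equiv.Perm ℝ)}
    (hG : ∀ g ∈ G, PLHomeo g) {A : Set ℝ} (hA : IsGroupOrbital G A) {g h : Equiv.Perm ℝ}
    (hg : g ∈ G) (hh : h ∈ G) {lo hi : ℝ} (hlohi : lo ≤ hi)
    (hmove : ∀ z, lo ≤ z → z ≤ hi → g z ≠ z ∨ h z ≠ z)
    (hgfix : ∃ z, lo ≤ z ∧ z ≤ hi ∧ g z = z) (hhfix : ∃ z, lo ≤ z ∧ z ≤ hi ∧ h z = z)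
    (hloA : (Set.Icc lo hi ∩ A).Nonempty) : HasTallTowers ⁅G, G⁆ A := by
  have pg := hG g hg
  have ph := hG h hh
  have hF : IsClosed {z | g z = z ∧ h z = z} :=
    pg.strictMono.isClosed_fixed.inter ph.strictMono.isClosed_fixed
  have hnot : ∀ z, lo ≤ z → z ≤ hi → z ∉ {z | g z = z ∧ h z = z} := fun z h1 h2 hz =>
    (hmove z h1 h2).elim (· hz.1) (· hz.2)
  have h01 : ∀ z, lo ≤ z → z ≤ hi → z ∈ Set.Ioo (0 : ℝ) 1 := fun z h1 h2 =>
    (hmove z h1 h2).elim pg.mem_Ioo ph.mem_Ioo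
  obtain ⟨α, hα, -, hαlo, hα'⟩ := hF.exists_last_below (hnot lo le_rfl hlohi)
    ⟨pg.apply_zero, ph.apply_zero⟩ (h01 lo le_rfl hlohi).1
  obtain ⟨β, hβ, -, hhiβ, hβ'⟩ := hF.exists_first_above (hnot hi hlohi le_rfl)
    ⟨pg.apply_one, ph.apply_one⟩ (h01 hi hlohi le_rfl).2
  have hαβ : α < β := hαlo.trans_le (hlohi.trans hhiβ.le)
  have hmv : ∀ z, α < z → z < β → g z ≠ z ∨ h z ≠ z := by
    intro z h1 h2
    rw [← not_and_or]
    rcases le_total z lo with h | h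
    · exact hα' z h1 h
    · rcases le_total z hi with h' | h'
      · exact hnot z h h'
      · exact hβ' z h' h2
  have hwiden : ∀ f : Equiv.Perm ℝ, (∃ z, lo ≤ z ∧ z ≤ hi ∧ f z = z) →
      ∃ z, α < z ∧ z < β ∧ f z = z := fun f ⟨z, h1, h2, h3⟩ =>
    ⟨z, hαlo.trans_le h1, h2.trans_lt hhiβ, h3⟩
  obtain ⟨f₁, hf₁, s, hsβ, hs⟩ := exists_movesOn_starting_at pg ph hαβ hα.1 hα.2 hmv
    (hwiden g hgfix) (hwiden h hhfix)
  obtain ⟨f₂, hf₂, r, hαr, hr⟩ := exists_movesOn_ending_at pg ph hαβ hβ.1 hβ.2 hmv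
    (hwiden g hgfix) (hwiden h hhfix)
  have hcl : Subgroup.closure {g, h} ≤ G := (Subgroup.closure_le G).2 (by
    rintro f (rfl | rfl) <;> assumption)
  have hclα : ∀ v ∈ Subgroup.closure {g, h}, v α = α := fun v hv =>
    apply_eq_self_of_mem_closure (by rintro f (rfl | rfl); exacts [hα.1, hα.2]) hv
  have hclβ : ∀ v ∈ Subgroup.closure {g, h}, v β = β := fun v hv =>
    apply_eq_self_of_mem_closure (by rintro f (rfl | rfl); exacts [hβ.1, hβ.2]) hv
  obtain ⟨v, hv, hrv⟩ := exists_lt_apply_of_moved (H := Subgroup.closure {g, h})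
    (fun v hv => (hG v (hcl hv)).strictMono)
    (fun z h1 h2 => (hmv z h1 h2).elim (fun h => ⟨g, Subgroup.subset_closure (by simp), h⟩)
      (fun h' => ⟨h, Subgroup.subset_closure (by simp), h'⟩)) hs.lt hr.lt
  have sv := (hG v (hcl hv)).strictMono
  have hf₁' := Subgroup.subset_closure hf₁
  have hf₂' := Subgroup.subset_closure hf₂
  have hconj := (Subgroup.closure {g, h}).mul_mem
    ((Subgroup.closure {g, h}).mul_mem hv hf₁') ((Subgroup.closure {g, h}).inv_mem hv)
  have hms := hs.conj sv
  rw [hclα v hv] at hms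
  have hvsβ : v s < β := (sv.apply_lt_iff_of_fixed (hclβ v hv)).2 hsβ
  obtain ⟨w, hw, u, hu, x, y, hm, hxs, hsy, hux, huy⟩ := exists_expanded_orbital hG (hcl hconj)
    (hcl hf₂') hrv hms hr (hclβ _ hconj) (hclα _ hf₂') hαr hvsβ
  refine hasTallTowers_of_expanded_orbital hG hA hw hu hm ⟨hxs, hsy⟩ ?_ hux huy
  have hsubA : Set.Ioo α β ⊆ A := by
    refine hA.subset_of_inter_nonempty isPreconnected_Ioo (fun z hz => ?_) ?_
    · exact (hmv z hz.1 hz.2).elim (fun h => ⟨g, hg, h⟩) (fun h' => ⟨h, hh, h'⟩)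
    · obtain ⟨z, hz, hzA⟩ := hloA
      exact ⟨z, ⟨hαlo.trans_le hz.1, hz.2.trans_lt hhiβ⟩, hzA⟩
  exact hsubA ⟨hms.lt, hvsβ⟩

/-- If `h` has an orbital `(a, q)` properly inside an orbital `(a, b)` of `g`, the commutator of
`h` with `g` or `g⁻¹` moves `q` and is trivial near `a`, so the derived subgroup has tall
towers. -/
theorem hasTallTowers_of_shared_left {G : Subgroup (Equiv.Perm ℝ)} (hG : ∀ g ∈ G, PLHomeo g)
    {A : Set ℝ} (hA : IsGroupOrbital G A) {g h : Equiv.Perm ℝ} (hg : g ∈ G) (hh : h ∈ G)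
    {a b q : ℝ} (hgab : MovesOn g a b) (hhaq : MovesOn h a q) (hqb : q < b)
    (hsubA : Set.Ioo a b ⊆ A) : HasTallTowers ⁅G, G⁆ A := by
  wlog hdir : g⁻¹ q < q generalizing g
  · refine this (G.inv_mem hg) hgab.inv ?_
    rw [inv_inv]
    rw [(hG g hg).strictMono.inv_lt_iff, not_lt] at hdir
    exact lt_of_le_of_ne hdir (hgab.ne q hhaq.lt hqb)
  have sg := (hG g hg).strictMono
  have hf : ⁅h, g⁆ ∈ G := commutator_self_le G (Subgroup.commutator_mem_commutator hh hg)
  have hfq : ⁅h, g⁆ q ≠ q := by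
    intro heq
    rw [commutatorElement_def, mul_assoc, mul_assoc, Equiv.Perm.mul_apply, ← mul_assoc,
      ← Equiv.Perm.eq_inv_iff_eq, inv_apply_eq_self hhaq.right, conj_apply_eq_self_iff] at heq
    exact hhaq.inv.ne _ (by rw [sg.lt_inv_iff, hgab.left]; exact hhaq.lt) hdir heq
  obtain ⟨c, hc, hcf⟩ := (hG h hh).commutator_right_trivial (hG g hg) hhaq.left hgab.left
  obtain ⟨lo, haq, hlo⟩ := exists_between (lt_min hc hhaq.lt)
  rw [lt_min_iff] at hlo
  refine hasTallTowers_of_no_common_fixed hG hA hh hf hlo.2.le (fun z h1 h2 => ?_)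
    ⟨q, hlo.2.le, le_rfl, hhaq.right⟩ ⟨lo, le_rfl, hlo.2.le, hcf lo haq.le hlo.1.le⟩
    ⟨q, ⟨hlo.2.le, le_rfl⟩, hsubA ⟨hhaq.lt, hqb⟩⟩
  rcases h2.lt_or_eq with h | rfl
  · exact Or.inl (hhaq.ne z (haq.trans_le h1) h)
  · exact Or.inr hfq

theorem hasTallTowers_of_shared_right {G : Subgroup (Equiv.Perm ℝ)} (hG : ∀ g ∈ G, PLHomeo g)
    {A : Set ℝ} (hA : IsGroupOrbital G A) {g h : Equiv.Perm ℝ} (hg : g ∈ G) (hh : h ∈ G)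
    {a b q : ℝ} (hgab : MovesOn g a b) (hhqb : MovesOn h q b) (haq : a < q)
    (hsubA : Set.Ioo a b ⊆ A) : HasTallTowers ⁅G, G⁆ A := by
  wlog hdir : q < g⁻¹ q generalizing g
  · refine this (G.inv_mem hg) hgab.inv ?_
    rw [inv_inv]
    rw [(hG g hg).strictMono.lt_inv_iff, not_lt] at hdir
    exact lt_of_le_of_ne hdir (hgab.ne q haq hhqb.lt).symm
  have sg := (hG g hg).strictMono
  have hf : ⁅h, g⁆ ∈ G := commutator_self_le G (Subgroup.commutator_mem_commutator hh hg)
  have hfq : ⁅h, g⁆ q ≠ q := by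
    intro heq
    rw [commutatorElement_def, mul_assoc, mul_assoc, Equiv.Perm.mul_apply, ← mul_assoc,
      ← Equiv.Perm.eq_inv_iff_eq, inv_apply_eq_self hhqb.left, conj_apply_eq_self_iff] at heq
    exact hhqb.inv.ne _ hdir (by rw [sg.inv_lt_iff, hgab.right]; exact hhqb.lt) heq
  obtain ⟨c, hc, hcf⟩ := (hG h hh).commutator_left_trivial (hG g hg) hhqb.right hgab.right
  obtain ⟨hi, hhi, hib⟩ := exists_between (max_lt hc hhqb.lt)
  rw [max_lt_iff] at hhi
  refine hasTallTowers_of_no_common_fixed hG hA hh hf hhi.2.le (fun z h1 h2 => ?_)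
    ⟨q, le_rfl, hhi.2.le, hhqb.left⟩ ⟨hi, hhi.2.le, le_rfl, hcf hi hhi.1.le hib.le⟩
    ⟨q, ⟨le_rfl, hhi.2.le⟩, hsubA ⟨haq, hhqb.lt⟩⟩
  rcases h1.lt_or_eq with h | rfl
  · exact Or.inl (hhqb.ne z h (h2.trans_lt hib))
  · exact Or.inr hfq

/-- An orbital of `h` properly inside an orbital of `g` is an orbital of some commutator, unless
the derived subgroup has tall towers. -/
theorem exists_commutator_movesOn {G : Subgroup (Equiv.Perm ℝ)} (hG : ∀ g ∈ G, PLHomeo g)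
    {A : Set ℝ} (hA : IsGroupOrbital G A) (htall : ¬ HasTallTowers ⁅G, G⁆ A)
    {g h : Equiv.Perm ℝ} (hg : g ∈ G) (hh : h ∈ G) {a b c d : ℝ} (hgab : MovesOn g a b)
    (hhcd : MovesOn h c d) (hac : a ≤ c) (hdb : d ≤ b) (hne : a < c ∨ d < b)
    (hsubA : Set.Ioo a b ⊆ A) : ∃ f ∈ ⁅G, G⁆, MovesOn f c d := by
  have ph := hG h hh
  have hha : h a = a := by
    by_contra hha
    have hac' : a < c := lt_of_le_of_ne hac fun e => hha (e ▸ hhcd.left)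
    have hcb : c < b := hhcd.lt.trans_le hdb
    refine htall (hasTallTowers_of_no_common_fixed hG hA hg hh hac (fun z h1 h2 => ?_)
      ⟨a, le_rfl, hac, hgab.left⟩ ⟨c, hac, le_rfl, hhcd.left⟩
      ⟨c, ⟨hac, le_rfl⟩, hsubA ⟨hac', hcb⟩⟩)
    rcases h1.lt_or_eq with h | rfl
    · exact Or.inl (hgab.ne z h (h2.trans_lt hcb))
    · exact Or.inr hha
  have hhb : h b = b := by
    by_contra hhb
    have hdb' : d < b := lt_of_le_of_ne hdb fun e => hhb (e ▸ hhcd.right)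
    have had : a < d := hac.trans_lt hhcd.lt
    refine htall (hasTallTowers_of_no_common_fixed hG hA hg hh hdb (fun z h1 h2 => ?_)
      ⟨b, hdb, le_rfl, hgab.right⟩ ⟨d, le_rfl, hdb, hhcd.right⟩
      ⟨d, ⟨le_rfl, hdb⟩, hsubA ⟨had, hdb'⟩⟩)
    rcases h2.lt_or_eq with h | rfl
    · exact Or.inl (hgab.ne z (had.trans_le h1) h)
    · exact Or.inr hhb
  obtain ⟨e, hae, heb, hhe⟩ : ∃ e, a < e ∧ e < b ∧ h e = e := by
    rcases hne with h' | h'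
    · exact ⟨c, h', hhcd.lt.trans_le hdb, hhcd.left⟩
    · exact ⟨d, hac.trans_lt hhcd.lt, h', hhcd.right⟩
  obtain ⟨l, hal, hlfix⟩ : ∃ l > a, ∀ y, a ≤ y → y ≤ l → h y = y := by
    refine (ph.right_dichotomy hha).resolve_right ?_
    rintro ⟨l, hal, hl⟩
    have hle : l < e := by
      by_contra! hcon
      exact hl e hae hcon hhe
    obtain ⟨x, q, hax, hxl, hlq, hqe, hm⟩ :=
      ph.strictMono.exists_movesOn hal hle hha hhe (hl l hal le_rfl)
    obtain rfl : x = a := by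
      by_contra hxa
      exact hl x (lt_of_le_of_ne hax (Ne.symm hxa)) hxl.le hm.left
    exact htall (hasTallTowers_of_shared_left hG hA hg hh hgab hm (hqe.trans_lt heb) hsubA)
  obtain ⟨r, hrb, hrfix⟩ : ∃ r < b, ∀ y, r ≤ y → y ≤ b → h y = y := by
    refine (ph.left_dichotomy hhb).resolve_right ?_
    rintro ⟨r, hrb, hr⟩
    have her : e < r := by
      by_contra! hcon
      exact hr e hcon heb hhe
    obtain ⟨q, x, heq, hqr, hrx, hxb, hm⟩ :=
      ph.strictMono.exists_movesOn her hrb hhe hhb (hr r le_rfl hrb)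
    obtain rfl : x = b := by
      by_contra hxb'
      exact hr x hrx.le (lt_of_le_of_ne hxb hxb') hm.right
    exact htall (hasTallTowers_of_shared_right hG hA hg hh hgab hm (hae.trans_le heq) hsubA)
  have hlc : l ≤ c := by
    by_contra! hcon
    obtain ⟨z, hz₁, hz₂⟩ := exists_between (lt_min hcon hhcd.lt)
    rw [lt_min_iff] at hz₂
    exact hhcd.ne z hz₁ hz₂.2 (hlfix z (hac.trans hz₁.le) hz₂.1.le)
  have hdr : d ≤ r := by
    by_contra! hcon
    obtain ⟨z, hz₁, hz₂⟩ := exists_between (max_lt hcon hhcd.lt)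
    rw [max_lt_iff] at hz₁
    exact hhcd.ne z hz₁.2 hz₂ (hrfix z hz₁.1.le (hz₂.le.trans hdb))
  have hgG : Subgroup.closure {g} ≤ G := (Subgroup.closure_le G).2 (by simpa using hg)
  obtain ⟨v, hv, hrv⟩ :=
    hgab.exists_lt_apply (fun v hv => (hG v (hgG hv)).strictMono) hal hrb
  have sv := (hG v (hgG hv)).strictMono
  have hva : v a = a := apply_eq_self_of_mem_closure (by simpa using hgab.left) hv
  have heq : ∀ z, c ≤ z → z ≤ d → ⁅h, v⁆ z = h z := by
    intro z hcz hzd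
    have h1 : a < v⁻¹ z := by
      rw [sv.lt_inv_iff, hva]
      linarith
    have h2 : v⁻¹ z < l := sv.inv_lt_iff.2 ((hzd.trans hdr).trans_lt hrv)
    rw [commutatorElement_def, mul_assoc, mul_assoc, Equiv.Perm.mul_apply, ← mul_assoc,
      conj_apply_eq_self_iff.2 (inv_apply_eq_self (hlfix _ h1.le h2.le))]
  refine ⟨⁅h, v⁆, Subgroup.commutator_mem_commutator hh (hgG hv), hhcd.lt, ?_, ?_, ?_⟩
  · rw [heq c le_rfl hhcd.lt.le, hhcd.left]
  · rw [heq d hhcd.lt.le le_rfl, hhcd.right]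
  · intro z h1 h2
    rw [heq z h1.le h2.le]
    exact hhcd.ne z h1 h2

end DerivedTowers

theorem stmt10 (G : Subgroup (Equiv.Perm ℝ)) (hG : ∀ g ∈ G, PLHomeo g) (n : ℕ)
    (hn : 1 ≤ n) (A : Set ℝ) (hA : IsGroupOrbital G A) (T : Set (Set ℝ × Equiv.Perm ℝ))
    (hT : IsTower G T) (hTfin : T.Finite) (hcard : T.ncard = n)
    (hsub : ∀ p ∈ T, p.1 ⊆ A) :
    ∃ T', IsTower ⁅G, G⁆ T' ∧ T'.Finite ∧ T'.ncard = n - 1 ∧ ∀ p ∈ T', p.1 ⊆ A := by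
  by_cases htall : HasTallTowers ⁅G, G⁆ A
  · exact htall (n - 1)
  obtain ⟨hmem, hchain, hinj⟩ := hT
  have hTne : T.Nonempty := by
    rw [← Set.ncard_pos hTfin]
    omega
  obtain ⟨M, hM, hmax⟩ := hTfin.exists_maximalFor Prod.fst T hTne
  obtain ⟨a, b, hMab, hgab⟩ := (hmem M hM).2.exists_movesOn (hG _ (hmem M hM).1)
  have hchoice : ∀ p : Set ℝ × Equiv.Perm ℝ, ∃ f, p ∈ T \ {M} →
      f ∈ ⁅G, G⁆ ∧ IsOrbital f p.1 := by
    intro p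
    by_cases hp : p ∈ T \ {M}
    · obtain ⟨c, d, hpcd, hhcd⟩ := (hmem p hp.1).2.exists_movesOn (hG _ (hmem p hp.1).1)
      have hle : p.1 ⊆ M.1 := (hchain p hp.1 M hM).elim id fun h => hmax hp.1 h
      have hne : p.1 ≠ M.1 := fun h => hp.2 (hinj p hp.1 M hM h)
      have hle' := hle
      rw [hpcd, hMab, Set.Ioo_subset_Ioo_iff hhcd.lt] at hle'
      obtain ⟨f, hf, hm⟩ := exists_commutator_movesOn hG hA htall (hmem M hM).1 (hmem p hp.1).1
        hgab hhcd hle'.1 hle'.2 (by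
          by_contra! hcon
          exact hne (by rw [hpcd, hMab, le_antisymm hcon.1 hle'.1, le_antisymm hle'.2 hcon.2]))
        (hMab ▸ hsub M hM)
      exact ⟨f, fun _ => ⟨hf, hpcd ▸ hm.isOrbital⟩⟩
    · exact ⟨1, fun h => absurd h hp⟩
  choose f hf using hchoice
  refine ⟨(fun p => (p.1, f p)) '' (T \ {M}), ⟨?_, ?_, ?_⟩, hTfin.sdiff.image _, ?_, ?_⟩
  · rintro _ ⟨p, hp, rfl⟩
    exact hf p hp
  · rintro _ ⟨p, hp, rfl⟩ _ ⟨q, hq, rfl⟩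
    exact hchain p hp.1 q hq.1
  · rintro _ ⟨p, hp, rfl⟩ _ ⟨q, hq, rfl⟩ hpq
    rw [hinj p hp.1 q hq.1 hpq]
  · rw [Set.InjOn.ncard_image, Set.ncard_sdiff_singleton_of_mem hM, hcard]
    intro p hp q hq hpq
    exact hinj p hp.1 q hq.1 (Prod.ext_iff.1 hpq).1
  · rintro _ ⟨p, hp, rfl⟩
    exact hsub p hp.1
end

section
/- A subgroup G of PL₊(I) is solvable of derived length exactly n if and only if the depth of G (the supremum of heights of towers of G) equals n. -/
namespace PLTower

open Filter Topology
open scoped commutatorElement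

/-- The open interval `(a, b)` is an orbital of `g`, in terms of its endpoints. -/
def IsOrb (g : Equiv.Perm ℝ) (a b : ℝ) : Prop :=
  a < b ∧ g a = a ∧ g b = b ∧ ∀ x, a < x → x < b → g x ≠ x

lemma continuous_of_strictMono {g : Equiv.Perm ℝ} (hg : StrictMono g) : Continuous g :=
  hg.monotone.continuous_of_surjective g.surjective

lemma strictMono_inv {g : Equiv.Perm ℝ} (hg : StrictMono g) : StrictMono ⇑g⁻¹ := by
  intro x y hxy
  rw [← hg.lt_iff_lt]
  simpa using hxy

lemma strictMono_pow {g : Equiv.Perm ℝ} (hg : StrictMono g) (n : ℕ) : StrictMono ⇑(g ^ n) := by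
  rw [Equiv.Perm.coe_pow]
  exact hg.iterate n

lemma inv_apply_eq_self {g : Equiv.Perm ℝ} {x : ℝ} : g⁻¹ x = x ↔ g x = x := by
  rw [Equiv.Perm.inv_eq_iff_eq, eq_comm]

lemma pow_apply_eq_self {g : Equiv.Perm ℝ} {x : ℝ} (hx : g x = x) (n : ℕ) : (g ^ n) x = x := by
  rw [Equiv.Perm.coe_pow]
  exact Function.iterate_fixed hx n

lemma inv_apply_lt {g : Equiv.Perm ℝ} (hg : StrictMono g) {x : ℝ} : g⁻¹ x < x ↔ x < g x := by
  rw [← hg.lt_iff_lt]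
  simp

lemma lt_inv_apply {g : Equiv.Perm ℝ} (hg : StrictMono g) {x : ℝ} : x < g⁻¹ x ↔ g x < x := by
  rw [← hg.lt_iff_lt]
  simp

/-- Every moved point lies in an orbital. -/
lemma exists_isOrb {g : Equiv.Perm ℝ} (hg : Homeo01 g) {x : ℝ} (hx : g x ≠ x) :
    ∃ a b, a < x ∧ x < b ∧ IsOrb g a b := by
  have hcl : IsClosed {y | g y = y} :=
    isClosed_eq (continuous_of_strictMono hg.1) continuous_id
  have hx01 : x ∈ Set.Ioo (0 : ℝ) 1 := by
    by_contra h
    exact hx (hg.2 x h)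
  have h0 : g 0 = 0 := hg.2 0 (by simp)
  have h1 : g 1 = 1 := hg.2 1 (by simp)
  obtain ⟨a, ⟨ha, ha'⟩, hamax⟩ := ((isCompact_Icc (a := (0 : ℝ)) (b := x)).inter_right
    hcl).exists_isGreatest ⟨0, ⟨le_rfl, hx01.1.le⟩, h0⟩
  obtain ⟨b, ⟨hb, hb'⟩, hbmin⟩ := ((isCompact_Icc (a := x) (b := (1 : ℝ))).inter_right
    hcl).exists_isLeast ⟨1, ⟨hx01.2.le, le_rfl⟩, h1⟩
  simp only [Set.mem_ofPred_eq] at ha' hb'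
  have hax : a < x := lt_of_le_of_ne ha.2 (by rintro rfl; exact hx ha')
  have hxb : x < b := lt_of_le_of_ne hb.1 (by rintro rfl; exact hx hb')
  refine ⟨a, b, hax, hxb, hax.trans hxb, ha', hb', fun y hay hyb hy => ?_⟩
  rcases le_total y x with h | h
  · exact (hamax ⟨⟨ha.1.trans hay.le, h⟩, hy⟩).not_gt hay
  · exact (hbmin ⟨⟨h, hyb.le.trans hb.2⟩, hy⟩).not_gt hyb

lemma connectedComponentIn_supp {g : Equiv.Perm ℝ} {a b x : ℝ} (h : IsOrb g a b) (hax : a < x)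
    (hxb : x < b) : connectedComponentIn (Supp g) x = Set.Ioo a b := by
  obtain ⟨-, ha, hb, hab⟩ := h
  apply subset_antisymm
  · have hoc : (connectedComponentIn (Supp g) x).OrdConnected :=
      isPreconnected_iff_ordConnected.1 isPreconnected_connectedComponentIn
    have hxm : x ∈ connectedComponentIn (Supp g) x :=
      mem_connectedComponentIn (hab x hax hxb)
    intro y hy
    constructor
    · by_contra hlt
      exact connectedComponentIn_subset _ _ (hoc.out hy hxm ⟨not_lt.1 hlt, hax.le⟩) ha
    · by_contra hlt
      exact connectedComponentIn_subset _ _ (hoc.out hxm hy ⟨hxb.le, not_lt.1 hlt⟩) hb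
  · exact isPreconnected_Ioo.subset_connectedComponentIn ⟨hax, hxb⟩ fun y hy => hab y hy.1 hy.2

lemma isOrbital_iff {g : Equiv.Perm ℝ} (hg : Homeo01 g) {A : Set ℝ} :
    IsOrbital g A ↔ ∃ a b, IsOrb g a b ∧ A = Set.Ioo a b := by
  constructor
  · rintro ⟨x, hx, rfl⟩
    obtain ⟨a, b, hax, hxb, h⟩ := exists_isOrb hg hx
    exact ⟨a, b, h, connectedComponentIn_supp h hax hxb⟩
  · rintro ⟨a, b, h, rfl⟩
    obtain ⟨x, hax, hxb⟩ := exists_between h.1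
    exact ⟨x, h.2.2.2 x hax hxb, (connectedComponentIn_supp h hax hxb).symm⟩

lemma IsOrb.inv {g : Equiv.Perm ℝ} {a b : ℝ} (h : IsOrb g a b) : IsOrb g⁻¹ a b :=
  ⟨h.1, inv_apply_eq_self.2 h.2.1, inv_apply_eq_self.2 h.2.2.1,
    fun x hax hxb hx => h.2.2.2 x hax hxb (inv_apply_eq_self.1 hx)⟩

lemma IsOrb.conj {g u : Equiv.Perm ℝ} {a b : ℝ} (h : IsOrb g a b) (hu : StrictMono u) :
    IsOrb (u * g * u⁻¹) (u a) (u b) := by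
  refine ⟨hu h.1, by simp [h.2.1], by simp [h.2.2.1], fun x hax hxb hx => ?_⟩
  refine h.2.2.2 (u⁻¹ x) ?_ ?_ ?_
  · rw [← hu.lt_iff_lt]; simpa using hax
  · rw [← hu.lt_iff_lt]; simpa using hxb
  · apply u.injective; simpa using hx

/-- A homeomorphism moves all points of an orbital in the same direction. -/
lemma IsOrb.lt_or_gt {g : Equiv.Perm ℝ} (hg : StrictMono g) {a b : ℝ} (h : IsOrb g a b) :
    (∀ x, a < x → x < b → x < g x) ∨ ∀ x, a < x → x < b → g x < x := by
  by_contra! hcon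
  obtain ⟨⟨x, hax, hxb, hx⟩, y, hay, hyb, hy⟩ := hcon
  have hc : ContinuousOn (fun z => g z - z) (Set.Ioo a b) :=
    ((continuous_of_strictMono hg).sub continuous_id).continuousOn
  obtain ⟨z, hz, hz0⟩ := isPreconnected_Ioo.intermediate_value (a := x) (b := y) ⟨hax, hxb⟩
    ⟨hay, hyb⟩ hc (show (0 : ℝ) ∈ Set.Icc _ _ from ⟨by simpa using hx, by simpa using hy⟩)
  exact h.2.2.2 z hz.1 hz.2 (sub_eq_zero.1 hz0)

/-- Up to inversion, a homeomorphism moves the points of an orbital to the right. -/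
lemma IsOrb.exists_right {G : Subgroup (Equiv.Perm ℝ)} {g : Equiv.Perm ℝ} (hgG : g ∈ G)
    (hg : StrictMono g) {a b : ℝ} (h : IsOrb g a b) :
    ∃ k ∈ G, StrictMono k ∧ IsOrb k a b ∧ ∀ x, a < x → x < b → x < k x := by
  rcases h.lt_or_gt hg with hr | hl
  · exact ⟨g, hgG, hg, h, hr⟩
  · exact ⟨g⁻¹, G.inv_mem hgG, strictMono_inv hg, h.inv,
      fun x hax hxb => (lt_inv_apply hg).2 (hl x hax hxb)⟩

/-- Points of an orbital are pushed beyond any other point of it. -/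
lemma exists_lt_pow {g : Equiv.Perm ℝ} (hg : StrictMono g) {a b x y : ℝ}
    (h : ∀ x, a < x → x < b → x < g x) (hax : a < x) (hyb : y < b) :
    ∃ n : ℕ, y < (g ^ n) x := by
  by_contra! hcon
  have hbdd : BddAbove (Set.range fun n : ℕ => (g ^ n) x) := ⟨y, by rintro _ ⟨n, rfl⟩; exact hcon n⟩
  set L := sSup (Set.range fun n : ℕ => (g ^ n) x)
  have hxL : x ≤ L := le_csSup hbdd ⟨0, by simp⟩
  have hLy : L ≤ y := csSup_le (Set.range_nonempty _) (by rintro _ ⟨n, rfl⟩; exact hcon n)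
  have hL := h L (hax.trans_le hxL) (hLy.trans_lt hyb)
  obtain ⟨_, ⟨n, rfl⟩, hn⟩ := exists_lt_of_lt_csSup (Set.range_nonempty _) ((inv_apply_lt hg).2 hL)
  have h1 : L < (g ^ (n + 1)) x := by
    have := hg hn
    rw [pow_succ', Equiv.Perm.mul_apply]
    simpa using this
  exact h1.not_ge (le_csSup hbdd ⟨n + 1, rfl⟩)

lemma le_pow_apply {g : Equiv.Perm ℝ} (hg : StrictMono g) {x : ℝ} (hx : x ≤ g x) (n : ℕ) :
    x ≤ (g ^ n) x := by
  induction n with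
  | zero => simp
  | succ n ih =>
    rw [pow_succ', Equiv.Perm.mul_apply]
    exact hx.trans (hg.monotone ih)

/-- The endpoints of a maximal orbital of a group are fixed by the group. -/
lemma fixed_of_maximal {G : Subgroup (Equiv.Perm ℝ)} (hG : ∀ g ∈ G, Homeo01 g)
    {k : Equiv.Perm ℝ} (hk : k ∈ G) {s t : ℝ} (hst : IsOrb k s t)
    (hmax : ∀ g ∈ G, ∀ a b, IsOrb g a b → a ≤ s → t ≤ b → a = s ∧ b = t)
    {h : Equiv.Perm ℝ} (hh : h ∈ G) : h s = s ∧ h t = t := by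
  have conj_max : ∀ u ∈ G, u s ≤ s → t ≤ u t → u s = s ∧ u t = t := fun u hu hs ht =>
    hmax _ (G.mul_mem (G.mul_mem hu hk) (G.inv_mem hu)) _ _ (hst.conj (hG u hu).1) hs ht
  have right_fixed : ∀ u ∈ G, ¬ t < u t := by
    intro h hh hht
    obtain ⟨k, hk, hkm, hst, hkr⟩ := hst.exists_right hk (hG k hk).1
    have hm := (hG h hh).1
    have hs : s < h s := by
      by_contra hs
      exact hht.ne' (conj_max h hh (not_lt.1 hs) hht.le).2
    obtain ⟨b₁, b₂, hb₁, hb₂, hb⟩ := exists_isOrb (hG h hh) hht.ne'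
    have hhr : ∀ x, b₁ < x → x < b₂ → x < h x := by
      rcases hb.lt_or_gt hm with h1 | h1
      · exact h1
      · exact absurd (h1 t hb₁ hb₂) hht.not_gt
    have hsb₁ : s < b₁ := by
      by_contra hle
      exact hb₂.ne' (hmax h hh _ _ hb (not_lt.1 hle) hb₂.le).2
    obtain ⟨x₀, hsx₀, hx₀⟩ := exists_between (lt_min hs hsb₁)
    obtain ⟨hx₀s, hx₀b⟩ := lt_min_iff.1 hx₀
    obtain ⟨M, hM⟩ := exists_lt_pow hkm hkr hsx₀ hb₁
    have hMm := strictMono_pow hkm M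
    have hMs : (k ^ M) s = s := pow_apply_eq_self hst.2.1 M
    have hMt : (k ^ M) t = t := pow_apply_eq_self hst.2.2.1 M
    have hw : ∀ x, s ≤ x → x ≤ t → x < (h * k ^ M) x := by
      intro x hsx hxt
      rw [Equiv.Perm.mul_apply]
      rcases hsx.eq_or_lt with rfl | hsx
      · rwa [hMs]
      rcases hxt.eq_or_lt with rfl | hxt
      · rwa [hMt]
      rcases le_total x x₀ with hx | hx
      · have := hm (hMm hsx)
        rw [hMs] at this
        exact (hx.trans_lt hx₀s).trans this
      rcases le_or_gt x b₁ with hxb | hxb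
      · have := hm (hM.trans_le (hMm.monotone hx))
        rw [hb.2.1] at this
        exact hxb.trans_lt this
      · have h1 := le_pow_apply hkm (hkr x hsx hxt).le M
        have h2 := hMm hxt
        rw [hMt] at h2
        exact h1.trans_lt (hhr _ (hxb.trans_le h1) (h2.trans hb₂))
    have hwG : h * k ^ M ∈ G := G.mul_mem hh (G.pow_mem hk M)
    obtain ⟨a, b, hat, htb, hab⟩ := exists_isOrb (hG _ hwG) (hw t hst.1.le le_rfl).ne'
    have has : a ≤ s := by
      by_contra hsa
      exact (hw a (not_le.1 hsa).le hat.le).ne' hab.2.1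
    exact htb.ne' (hmax _ hwG _ _ hab has htb.le).2
  have ht : ∀ u ∈ G, u t = t := by
    intro u hu
    apply le_antisymm (not_lt.1 (right_fixed u hu))
    by_contra hlt
    exact right_fixed _ (G.inv_mem hu) ((lt_inv_apply (hG u hu).1).2 (not_le.1 hlt))
  refine ⟨?_, ht h hh⟩
  rcases le_total (h s) s with hs | hs
  · exact (conj_max h hh hs (ht h hh).ge).1
  · refine inv_apply_eq_self.1 (conj_max _ (G.inv_mem hh) ?_ (ht _ (G.inv_mem hh)).ge).1
    rw [← (hG h hh).1.le_iff_le]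
    simpa using hs

/-- A map that is locally affine on an interval is affine on it. -/
lemma exists_affine_of_locallyAffineAt {f : ℝ → ℝ} {a b : ℝ} (hab : a < b)
    (hf : ∀ x ∈ Set.Ioo a b, LocallyAffineAt f x) :
    ∃ m c : ℝ, ∀ x ∈ Set.Ioo a b, f x = m * x + c := by
  have hloc : ∀ x ∈ Set.Ioo a b, ∃ m c : ℝ, f =ᶠ[𝓝 x] fun y => m * y + c := by
    intro x hx
    obtain ⟨ε, hε, m, c, h⟩ := hf x hx
    refine ⟨m, c, Metric.eventually_nhds_iff.2 ⟨ε, hε, fun y hy => h y ?_⟩⟩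
    rwa [Real.dist_eq] at hy
  have haff : ∀ (m c x : ℝ), AnalyticAt ℝ (fun y : ℝ => m * y + c) x := fun m c x =>
    (analyticAt_const.mul analyticAt_id).add analyticAt_const
  obtain ⟨z, hz⟩ := exists_between hab
  obtain ⟨m, c, hmc⟩ := hloc z hz
  refine ⟨m, c, AnalyticOnNhd.eqOn_of_preconnected_of_eventuallyEq (𝕜 := ℝ) (fun x hx => ?_)
    (fun x _ => haff m c x) isPreconnected_Ioo hz hmc⟩
  obtain ⟨m', c', h⟩ := hloc x hx
  exact (haff m' c' x).congr h.symm

lemma eventually_locallyAffineAt {f : ℝ → ℝ} (hf : IsPL f) (p : ℝ) :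
    ∃ ε > 0, ∀ x, |x - p| < ε → x ≠ p → LocallyAffineAt f x := by
  have h : ∀ᶠ x in 𝓝[≠] p, LocallyAffineAt f x := by
    have := (hf.subset (Set.sdiff_subset (t := {p}))).isClosed.isOpen_compl.mem_nhds
      (show p ∈ _ by simp)
    rw [eventually_nhdsWithin_iff]
    filter_upwards [this] with x hx hxp
    by_contra hcon
    exact hx ⟨hcon, hxp⟩
  rw [eventually_nhdsWithin_iff, Metric.eventually_nhds_iff] at h
  obtain ⟨ε, hε, h⟩ := h
  exact ⟨ε, hε, fun x hx hxp => h (by rwa [Real.dist_eq]) hxp⟩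

/-- The germ at a fixed point, on either side, of a piecewise linear homeomorphism is linear. -/
lemma exists_linear_germ {g : Equiv.Perm ℝ} (hg : PLHomeo g) {p : ℝ} (hp : g p = p) :
    (∃ m : ℝ, ∀ᶠ y in 𝓝[>] p, g y = p + m * (y - p)) ∧
      ∃ m : ℝ, ∀ᶠ y in 𝓝[<] p, g y = p + m * (y - p) := by
  have key : ∀ (l : Filter ℝ) [l.NeBot], l ≤ 𝓝 p →
      (∃ m c : ℝ, ∀ᶠ y in l, g y = m * y + c) → ∃ m : ℝ, ∀ᶠ y in l, g y = p + m * (y - p) := by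
    rintro l _ hl ⟨m, c, h⟩
    have h1 : Tendsto g l (𝓝 p) := by
      have := (continuous_of_strictMono hg.1.1).tendsto p
      rw [hp] at this
      exact this.mono_left hl
    have h2 : Tendsto (fun y : ℝ => m * y + c) l (𝓝 (m * p + c)) :=
      (Continuous.tendsto (by fun_prop) p).mono_left hl
    have h3 : p = m * p + c := tendsto_nhds_unique h1 (h2.congr' (h.mono fun y hy => hy.symm))
    exact ⟨m, h.mono fun y hy => by rw [hy]; linarith⟩
  obtain ⟨ε, hε, h⟩ := eventually_locallyAffineAt hg.2 p
  constructor
  · apply key _ nhdsWithin_le_nhds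
    obtain ⟨m, c, hmc⟩ := exists_affine_of_locallyAffineAt (f := g) (show p < p + ε by linarith)
      fun x hx => h x (by rw [abs_lt]; constructor <;> linarith [hx.1, hx.2]) hx.1.ne'
    exact ⟨m, c, eventually_of_mem (Ioo_mem_nhdsGT (by linarith)) hmc⟩
  · apply key _ nhdsWithin_le_nhds
    obtain ⟨m, c, hmc⟩ := exists_affine_of_locallyAffineAt (f := g) (show p - ε < p by linarith)
      fun x hx => h x (by rw [abs_lt]; constructor <;> linarith [hx.1, hx.2]) hx.2.ne
    exact ⟨m, c, eventually_of_mem (Ioo_mem_nhdsLT (by linarith)) hmc⟩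

lemma tendsto_nhdsGT_of_fixed {g : Equiv.Perm ℝ} (hg : StrictMono g) {p : ℝ} (hp : g p = p) :
    Tendsto g (𝓝[>] p) (𝓝[>] p) := by
  refine tendsto_nhdsWithin_iff.2 ⟨?_, ?_⟩
  · have := (continuous_of_strictMono hg).tendsto p
    rw [hp] at this
    exact this.mono_left nhdsWithin_le_nhds
  · filter_upwards [self_mem_nhdsWithin] with y hy
    have := hg (show p < y from hy)
    rwa [hp] at this

lemma tendsto_nhdsLT_of_fixed {g : Equiv.Perm ℝ} (hg : StrictMono g) {p : ℝ} (hp : g p = p) :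
    Tendsto g (𝓝[<] p) (𝓝[<] p) := by
  refine tendsto_nhdsWithin_iff.2 ⟨?_, ?_⟩
  · have := (continuous_of_strictMono hg).tendsto p
    rw [hp] at this
    exact this.mono_left nhdsWithin_le_nhds
  · filter_upwards [self_mem_nhdsWithin] with y hy
    have := hg (show y < p from hy)
    rwa [hp] at this

lemma commutatorElement_germ {g h : Equiv.Perm ℝ} {p : ℝ} {l : Filter ℝ}
    (hg' : ∃ m : ℝ, ∀ᶠ y in l, g y = p + m * (y - p))
    (hh' : ∃ m : ℝ, ∀ᶠ y in l, h y = p + m * (y - p))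
    (hgl : Tendsto g l l) (hhl : Tendsto h l l)
    (hgl' : Tendsto ⇑g⁻¹ l l) (hhl' : Tendsto ⇑h⁻¹ l l) :
    ∀ᶠ y in l, ⁅g, h⁆ y = y := by
  obtain ⟨m, hm⟩ := hg'
  obtain ⟨n, hn⟩ := hh'
  have hcomm : ∀ᶠ y in l, g (h y) = h (g y) := by
    filter_upwards [hm, hn, hhl.eventually hm, hgl.eventually hn] with y h1 h2 h3 h4
    rw [h3, h4, h1, h2]
    ring
  filter_upwards [(hgl'.comp hhl').eventually hcomm] with y hy
  simp only [Function.comp_apply] at hy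
  simp only [commutatorElement_def, Equiv.Perm.mul_apply]
  rw [hy]
  simp

lemma commutatorElement_germ_right {g h : Equiv.Perm ℝ} (hg : PLHomeo g) (hh : PLHomeo h) {p : ℝ}
    (hgp : g p = p) (hhp : h p = p) : ∀ᶠ y in 𝓝[>] p, ⁅g, h⁆ y = y :=
  commutatorElement_germ (exists_linear_germ hg hgp).1 (exists_linear_germ hh hhp).1
    (tendsto_nhdsGT_of_fixed hg.1.1 hgp) (tendsto_nhdsGT_of_fixed hh.1.1 hhp)
    (tendsto_nhdsGT_of_fixed (strictMono_inv hg.1.1) (inv_apply_eq_self.2 hgp))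
    (tendsto_nhdsGT_of_fixed (strictMono_inv hh.1.1) (inv_apply_eq_self.2 hhp))

lemma commutatorElement_germ_left {g h : Equiv.Perm ℝ} (hg : PLHomeo g) (hh : PLHomeo h) {p : ℝ}
    (hgp : g p = p) (hhp : h p = p) : ∀ᶠ y in 𝓝[<] p, ⁅g, h⁆ y = y :=
  commutatorElement_germ (exists_linear_germ hg hgp).2 (exists_linear_germ hh hhp).2
    (tendsto_nhdsLT_of_fixed hg.1.1 hgp) (tendsto_nhdsLT_of_fixed hh.1.1 hhp)
    (tendsto_nhdsLT_of_fixed (strictMono_inv hg.1.1) (inv_apply_eq_self.2 hgp))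
    (tendsto_nhdsLT_of_fixed (strictMono_inv hh.1.1) (inv_apply_eq_self.2 hhp))

lemma IsOrb.not_germ_right {f : Equiv.Perm ℝ} {a b : ℝ} (h : IsOrb f a b) :
    ¬ ∀ᶠ y in 𝓝[>] a, f y = y := by
  intro hf
  obtain ⟨y, hy, hy'⟩ := (hf.and (Ioo_mem_nhdsGT h.1)).exists
  exact h.2.2.2 y hy'.1 hy'.2 hy

lemma IsOrb.not_germ_left {f : Equiv.Perm ℝ} {a b : ℝ} (h : IsOrb f a b) :
    ¬ ∀ᶠ y in 𝓝[<] b, f y = y := by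
  intro hf
  obtain ⟨y, hy, hy'⟩ := (hf.and (Ioo_mem_nhdsLT h.1)).exists
  exact h.2.2.2 y hy'.1 hy'.2 hy

/-- The permutations with trivial germ along a filter. -/
def trivialGerm (l : Filter ℝ) : Subgroup (Equiv.Perm ℝ) where
  carrier := {g | ∀ᶠ y in l, g y = y}
  one_mem' := by simp
  mul_mem' := by
    intro g h hg hh
    filter_upwards [hg, hh] with y h1 h2
    rw [Equiv.Perm.mul_apply, h2, h1]
  inv_mem' := by
    intro g hg
    filter_upwards [hg] with y h1
    exact inv_apply_eq_self.2 h1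

/-- An orbital of the derived subgroup is properly contained in an orbital of the group. -/
lemma exists_larger_isOrb {G : Subgroup (Equiv.Perm ℝ)} (hG : ∀ g ∈ G, PLHomeo g)
    {f : Equiv.Perm ℝ} (hf : f ∈ ⁅G, G⁆) {s t : ℝ} (hst : IsOrb f s t) :
    ∃ g ∈ G, ∃ a b, IsOrb g a b ∧ a ≤ s ∧ t ≤ b ∧ ¬ (a = s ∧ b = t) := by
  by_contra! hcon
  have hfix : ∀ h ∈ G, h s = s := fun h hh => (fixed_of_maximal (fun g hg => (hG g hg).1)
    (Subgroup.commutator_le_self G hf) hst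
    (fun g hg a b hab ha hb => hcon g hg a b hab ha hb) hh).1
  have hle : ⁅G, G⁆ ≤ trivialGerm (𝓝[>] s) := Subgroup.commutator_le.2 fun g hg h hh =>
    commutatorElement_germ_right (hG g hg) (hG h hh) (hfix g hg) (hfix h hh)
  exact hst.not_germ_right (hle hf)

/-- Every finite chain of orbitals of `G` has at most `n` members. -/
def DepthLe (G : Subgroup (Equiv.Perm ℝ)) (n : ℕ) : Prop :=
  ∀ S : Finset (ℝ × ℝ), (∀ p ∈ S, ∃ g ∈ G, IsOrb g p.1 p.2) →
    (∀ p ∈ S, ∀ q ∈ S, (q.1 ≤ p.1 ∧ p.2 ≤ q.2) ∨ (p.1 ≤ q.1 ∧ q.2 ≤ p.2)) → S.card ≤ n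

/-- No two orbitals of `G` overlap properly. -/
def NoOverlap (G : Subgroup (Equiv.Perm ℝ)) : Prop :=
  ∀ g ∈ G, ∀ h ∈ G, ∀ a₁ a₂ b₁ b₂ : ℝ, IsOrb g a₁ a₂ → IsOrb h b₁ b₂ →
    a₁ < b₁ → b₁ < a₂ → ¬ a₂ < b₂

lemma conj_mem_commutator {G : Subgroup (Equiv.Perm ℝ)} {u f : Equiv.Perm ℝ} (hu : u ∈ G)
    (hf : f ∈ ⁅G, G⁆) : u * f * u⁻¹ ∈ ⁅G, G⁆ := by
  have h1 : ⁅u, f⁆ ∈ ⁅G, G⁆ :=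
    Subgroup.commutator_mem_commutator hu (Subgroup.commutator_le_self G hf)
  have := mul_mem h1 hf
  simpa [commutatorElement_def] using this

/-- In finite depth, no element maps an orbital of the derived subgroup properly into itself. -/
lemma DepthLe.fixed_of_shrinking {G : Subgroup (Equiv.Perm ℝ)} {n : ℕ} (hn : DepthLe ⁅G, G⁆ n)
    {f : Equiv.Perm ℝ} (hf : f ∈ ⁅G, G⁆) {c d : ℝ} (hcd : IsOrb f c d)
    {u : Equiv.Perm ℝ} (hu : u ∈ G) (hum : StrictMono u) (hc : c ≤ u c) (hd : u d ≤ d) :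
    u c = c ∧ u d = d := by
  by_contra hne
  have mono : Monotone fun i : ℕ => (u ^ i) c := monotone_nat_of_le_succ fun i => by
    simp only [pow_succ, Equiv.Perm.mul_apply]
    exact (strictMono_pow hum i).monotone hc
  have anti : Antitone fun i : ℕ => (u ^ i) d := antitone_nat_of_succ_le fun i => by
    simp only [pow_succ, Equiv.Perm.mul_apply]
    exact (strictMono_pow hum i).monotone hd
  have inj : Function.Injective fun i : ℕ => ((u ^ i) c, (u ^ i) d) := by
    by_cases hcc : u c = c
    · have hdd : u d < d := lt_of_le_of_ne hd fun h => hne ⟨hcc, h⟩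
      have : StrictAnti fun i : ℕ => (u ^ i) d := strictAnti_nat_of_succ_lt fun i => by
        simp only [pow_succ, Equiv.Perm.mul_apply]
        exact strictMono_pow hum i hdd
      exact fun i j hij => this.injective (Prod.ext_iff.1 hij).2
    · have hcc : c < u c := lt_of_le_of_ne hc (Ne.symm hcc)
      have : StrictMono fun i : ℕ => (u ^ i) c := strictMono_nat_of_lt_succ fun i => by
        simp only [pow_succ, Equiv.Perm.mul_apply]
        exact strictMono_pow hum i hcc
      exact fun i j hij => this.injective (Prod.ext_iff.1 hij).1
  have := hn ((Finset.range (n + 1)).image fun i : ℕ => ((u ^ i) c, (u ^ i) d)) ?_ ?_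
  · rw [Finset.card_image_of_injective _ inj, Finset.card_range] at this
    omega
  · simp only [Finset.mem_image]
    rintro _ ⟨i, -, rfl⟩
    exact ⟨_, conj_mem_commutator (G.pow_mem hu i) hf, hcd.conj (strictMono_pow hum i)⟩
  · simp only [Finset.mem_image]
    rintro _ ⟨i, -, rfl⟩ _ ⟨j, -, rfl⟩
    rcases le_total i j with hij | hij
    · exact Or.inr ⟨mono hij, anti hij⟩
    · exact Or.inl ⟨mono hij, anti hij⟩

lemma inv_commutator_moves {g h : Equiv.Perm ℝ} {x : ℝ} (hx : g x = x)
    (hgx : g (h⁻¹ x) ≠ h⁻¹ x) : ⁅g⁻¹, h⁆ x ≠ x := by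
  intro hcon
  simp only [commutatorElement_def, inv_inv, Equiv.Perm.mul_apply] at hcon
  rw [Equiv.Perm.inv_eq_iff_eq, hx] at hcon
  apply hgx
  apply h.injective
  simpa using hcon

lemma NoOverlap.of_commutator {G : Subgroup (Equiv.Perm ℝ)} (hG : ∀ g ∈ G, PLHomeo g) {n : ℕ}
    (hn : DepthLe ⁅G, G⁆ n) (hno : NoOverlap ⁅G, G⁆) : NoOverlap G := by
  intro g hg h hh a₁ a₂ b₁ b₂ hga hhb h1 h2 h3
  obtain ⟨h, hh, hhm, hhb, hr⟩ := hhb.exists_right hh (hG h hh).1.1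
  have hgm := (hG g hg).1.1
  have hf : ⁅g⁻¹, h⁆ ∈ ⁅G, G⁆ := Subgroup.commutator_mem_commutator (G.inv_mem hg) hh
  have hf01 := (hG _ (Subgroup.commutator_le_self G hf)).1
  have hmove : ⁅g⁻¹, h⁆ a₂ ≠ a₂ := by
    have h4 : b₁ < h⁻¹ a₂ := by
      rw [← hhm.lt_iff_lt, hhb.2.1]
      simpa using h2
    exact inv_commutator_moves hga.2.2.1
      (hga.2.2.2 _ (h1.trans h4) ((inv_apply_lt hhm).2 (hr _ h2 h3)))
  obtain ⟨c, d, hc, hd, hcd⟩ := exists_isOrb hf01 hmove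
  have stable : ∀ u ∈ G, u c < d → c < u d → u c = c ∧ u d = d := by
    intro u hu huc hud
    have hum := (hG u hu).1.1
    have hcd' := hcd.conj hum
    have hfu := conj_mem_commutator hu hf
    rcases lt_or_ge c (u c) with hlt | hle
    · exact hn.fixed_of_shrinking hf hcd hu hum hlt.le
        (not_lt.1 (hno _ hf _ hfu _ _ _ _ hcd hcd' hlt huc))
    · rcases hle.lt_or_eq with hlt | heq
      · have hdu : d ≤ u d := not_lt.1 (hno _ hfu _ hf _ _ _ _ hcd' hcd hlt hud)
        have := hn.fixed_of_shrinking hf hcd (G.inv_mem hu) (strictMono_inv hum)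
          (by rw [← hum.le_iff_le]; simpa using hle) (by rw [← hum.le_iff_le]; simpa using hdu)
        exact ⟨inv_apply_eq_self.1 this.1, inv_apply_eq_self.1 this.2⟩
      · rcases le_total (u d) d with h5 | h5
        · exact hn.fixed_of_shrinking hf hcd hu hum heq.ge h5
        · have := hn.fixed_of_shrinking hf hcd (G.inv_mem hu) (strictMono_inv hum)
            (by rw [← hum.le_iff_le]; simpa using hle) (by rw [← hum.le_iff_le]; simpa using h5)
          exact ⟨inv_apply_eq_self.1 this.1, inv_apply_eq_self.1 this.2⟩
  have hgc : g c = c := by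
    have h4 := hgm hc
    have h5 := hgm hd
    rw [hga.2.2.1] at h4 h5
    exact (stable g hg (h4.trans hd) (hc.trans h5)).1
  have hca : c ≤ a₁ := by
    by_contra hlt
    exact hga.2.2.2 c (not_le.1 hlt) hc hgc
  have hcb : c < b₁ := hca.trans_lt h1
  have hbd : b₁ < d := h2.trans hd
  have hhc : h c = c := by
    have h4 := hhm hcb
    have h5 := hhm hbd
    rw [hhb.2.1] at h4 h5
    exact (stable h hh (h4.trans hbd) (hcb.trans h5)).1
  exact hcd.not_germ_right (commutatorElement_germ_right (hG _ (G.inv_mem hg)) (hG h hh)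
    (inv_apply_eq_self.2 hgc) hhc)

lemma NoOverlap.not_share_left {G : Subgroup (Equiv.Perm ℝ)} (hno : NoOverlap G)
    (hG : ∀ g ∈ G, PLHomeo g) {g h : Equiv.Perm ℝ} (hg : g ∈ G) (hh : h ∈ G) {a b c : ℝ}
    (hgo : IsOrb g a b) (hho : IsOrb h a c) : ¬ b < c := by
  intro hbc
  obtain ⟨h, hh, hhm, hho, hr⟩ := hho.exists_right hh (hG h hh).1.1
  have hf : ⁅g⁻¹, h⁆ ∈ G := Subgroup.commutator_le_self G
    (Subgroup.commutator_mem_commutator (G.inv_mem hg) hh)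
  have hmove : ⁅g⁻¹, h⁆ b ≠ b := by
    refine inv_commutator_moves hgo.2.2.1
      (hgo.2.2.2 _ ?_ ((inv_apply_lt hhm).2 (hr _ hgo.1 hbc)))
    rw [← hhm.lt_iff_lt, hho.2.1]
    simpa using hgo.1
  have hga : g⁻¹ a = a := inv_apply_eq_self.2 hgo.2.1
  have hha : h⁻¹ a = a := inv_apply_eq_self.2 hho.2.1
  have hfa : ⁅g⁻¹, h⁆ a = a := by
    simp only [commutatorElement_def, inv_inv, Equiv.Perm.mul_apply, hga, hha, hgo.2.1, hho.2.1]
  obtain ⟨c', d', hc, hd, hcd⟩ := exists_isOrb (hG _ hf).1 hmove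
  rcases lt_trichotomy a c' with hlt | rfl | hlt
  · exact hno g hg _ hf _ _ _ _ hgo hcd hlt hc hd
  · exact hcd.not_germ_right
      (commutatorElement_germ_right (hG _ (G.inv_mem hg)) (hG h hh) hga hho.2.1)
  · exact hcd.2.2.2 a hlt (hgo.1.trans hd) hfa

lemma NoOverlap.not_share_right {G : Subgroup (Equiv.Perm ℝ)} (hno : NoOverlap G)
    (hG : ∀ g ∈ G, PLHomeo g) {g h : Equiv.Perm ℝ} (hg : g ∈ G) (hh : h ∈ G) {a b c : ℝ}
    (hgo : IsOrb g a b) (hho : IsOrb h c b) : ¬ c < a := by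
  intro hca
  obtain ⟨k, hk, hkm, hko, hr⟩ := hho.exists_right hh (hG h hh).1.1
  obtain ⟨h, rfl⟩ : ∃ h, h⁻¹ = k := ⟨k⁻¹, inv_inv k⟩
  have hh : h ∈ G := G.inv_mem_iff.1 hk
  have hhm : StrictMono h := (hG h hh).1.1
  have hho : IsOrb h c b := by simpa using hko.inv
  have hf : ⁅g⁻¹, h⁆ ∈ G := Subgroup.commutator_le_self G
    (Subgroup.commutator_mem_commutator (G.inv_mem hg) hh)
  have hmove : ⁅g⁻¹, h⁆ a ≠ a := by
    refine inv_commutator_moves hgo.2.1 (hgo.2.2.2 _ (hr _ hca hgo.1) ?_)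
    rw [← hhm.lt_iff_lt, hho.2.2.1]
    simpa using hgo.1
  have hgb : g⁻¹ b = b := inv_apply_eq_self.2 hgo.2.2.1
  have hhb : h⁻¹ b = b := inv_apply_eq_self.2 hho.2.2.1
  have hfb : ⁅g⁻¹, h⁆ b = b := by
    simp only [commutatorElement_def, inv_inv, Equiv.Perm.mul_apply, hgb, hhb, hgo.2.2.1,
      hho.2.2.1]
  obtain ⟨c', d', hc, hd, hcd⟩ := exists_isOrb (hG _ hf).1 hmove
  rcases lt_trichotomy d' b with hlt | rfl | hlt
  · exact hno _ hf g hg _ _ _ _ hcd hgo hc hd hlt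
  · exact hcd.not_germ_left
      (commutatorElement_germ_left (hG _ (G.inv_mem hg)) (hG h hh) hgb hho.2.2.1)
  · exact hcd.2.2.2 b (hc.trans hgo.1) hlt hfb

/-- Near the left end of an orbital, an element with a smaller orbital is trivial. -/
lemma NoOverlap.germ_right {G : Subgroup (Equiv.Perm ℝ)} (hno : NoOverlap G)
    (hG : ∀ g ∈ G, PLHomeo g) {g h : Equiv.Perm ℝ} (hg : g ∈ G) (hh : h ∈ G) {a b p q : ℝ}
    (hgo : IsOrb g a b) (hho : IsOrb h p q) (hpa : p < a) (hbq : b ≤ q) :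
    ∀ᶠ y in 𝓝[>] p, g y = y := by
  have hg01 := (hG g hg).1
  have hend : ∀ x y, IsOrb g x y → x < a → y ≤ a := fun x y hxy hxa => by
    by_contra hlt
    exact hxy.2.2.2 a hxa (not_le.1 hlt) hgo.2.1
  have haq : a < q := hgo.1.trans_le hbq
  have hgp : g p = p := by
    by_contra hne
    obtain ⟨x, y, hx, hy, hxy⟩ := exists_isOrb hg01 hne
    exact hno g hg h hh _ _ _ _ hxy hho hx hy ((hend x y hxy (hx.trans hpa)).trans_lt haq)
  obtain ⟨m, hm⟩ := (exists_linear_germ (hG g hg) hgp).1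
  by_cases hm1 : m = 1
  · filter_upwards [hm] with y hy
    rw [hy, hm1]
    ring
  obtain ⟨e, he, hpe⟩ := (mem_nhdsGT_iff_exists_Ioo_subset).1 hm
  obtain ⟨z, hpz, hz⟩ := exists_between (lt_min hpa he)
  obtain ⟨hza, hze⟩ := lt_min_iff.1 hz
  have hne : ∀ x, p < x → x < e → g x ≠ x := by
    intro x hpx hxe hx
    have h1 : g x = p + m * (x - p) := hpe ⟨hpx, hxe⟩
    have h2 : (m - 1) * (x - p) = 0 := by linarith
    rcases mul_eq_zero.1 h2 with h3 | h3
    · exact hm1 (by linarith)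
    · linarith
  obtain ⟨x, y, hx, hy, hxy⟩ := exists_isOrb hg01 (hne z hpz hze)
  have hxp : x = p := by
    rcases lt_trichotomy x p with hlt | heq | hlt
    · exact absurd hgp (hxy.2.2.2 p hlt (hpz.trans hy))
    · exact heq
    · exact absurd hxy.2.1 (hne x hlt (hx.trans hze))
  subst hxp
  exact absurd ((hend x y hxy hpa).trans_lt haq) (hno.not_share_left hG hg hh hxy hho)

/-- An orbital properly contained in another one is an orbital of the derived subgroup. -/
lemma NoOverlap.exists_commutator_isOrb {G : Subgroup (Equiv.Perm ℝ)} (hno : NoOverlap G)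
    (hG : ∀ g ∈ G, PLHomeo g) {g h : Equiv.Perm ℝ} (hg : g ∈ G) (hh : h ∈ G) {a b p q : ℝ}
    (hgo : IsOrb g a b) (hho : IsOrb h p q) (hpa : p ≤ a) (hbq : b ≤ q)
    (hne : ¬ (p = a ∧ b = q)) : ∃ f ∈ ⁅G, G⁆, IsOrb f a b := by
  have hpa' : p < a := by
    refine lt_of_le_of_ne hpa ?_
    rintro rfl
    exact hno.not_share_left hG hg hh hgo hho (lt_of_le_of_ne hbq fun h => hne ⟨rfl, h⟩)
  have hbq' : b < q := by
    refine lt_of_le_of_ne hbq ?_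
    rintro rfl
    exact hno.not_share_right hG hg hh hgo hho hpa'
  obtain ⟨p', hp', hgp⟩ :=
    (mem_nhdsGT_iff_exists_Ioo_subset).1 (hno.germ_right hG hg hh hgo hho hpa' hbq)
  obtain ⟨h, hh, hhm, hho, hr⟩ := hho.exists_right hh (hG h hh).1.1
  have hp'a : p' ≤ a := by
    by_contra hlt
    obtain ⟨z, hz1, hz2⟩ := exists_between (lt_min (not_le.1 hlt) hgo.1)
    obtain ⟨hz2, hz3⟩ := lt_min_iff.1 hz2
    exact hgo.2.2.2 z hz1 hz3 (hgp ⟨hpa'.trans hz1, hz2⟩)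
  obtain ⟨M, hM⟩ := exists_lt_pow hhm hr hp' hbq'
  have hum := strictMono_pow hhm M
  have huG := G.pow_mem hh M
  have hup : (h ^ M) p = p := pow_apply_eq_self hho.2.1 M
  set u := h ^ M
  have heq : ∀ x, a ≤ x → x ≤ b → ⁅g, u⁆ x = g x := by
    intro x hax hxb
    have h1 : g (u⁻¹ x) = u⁻¹ x := by
      refine hgp ⟨?_, ?_⟩
      · rw [← hum.lt_iff_lt, hup]
        simpa using hpa'.trans_le hax
      · rw [← hum.lt_iff_lt]
        simpa using hxb.trans_lt hM
    have h2 : g⁻¹ (u⁻¹ x) = u⁻¹ x := inv_apply_eq_self.2 h1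
    simp only [commutatorElement_def, Equiv.Perm.mul_apply, h2]
    simp
  refine ⟨⁅g, u⁆, Subgroup.commutator_mem_commutator hg huG, hgo.1, ?_, ?_, fun x hax hxb => ?_⟩
  · rw [heq a le_rfl hgo.1.le, hgo.2.1]
  · rw [heq b hgo.1.le le_rfl, hgo.2.2.1]
  · rw [heq x hax.le hxb.le]
    exact hgo.2.2.2 x hax hxb

lemma DepthLe.succ {G : Subgroup (Equiv.Perm ℝ)} (hG : ∀ g ∈ G, PLHomeo g) {n : ℕ}
    (hn : DepthLe ⁅G, G⁆ n) (hno : NoOverlap G) : DepthLe G (n + 1) := by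
  intro S hS hchain
  rcases S.eq_empty_or_nonempty with rfl | hne
  · simp
  obtain ⟨r, hr, hrmax⟩ := S.exists_max_image (fun p => p.2 - p.1) hne
  have htop : ∀ p ∈ S, r.1 ≤ p.1 ∧ p.2 ≤ r.2 := by
    intro p hp
    have := hrmax p hp
    rcases hchain p hp r hr with h | h
    · exact h
    · constructor <;> linarith
  have := hn (S.erase r) ?_ fun p hp q hq =>
    hchain p (Finset.mem_of_mem_erase hp) q (Finset.mem_of_mem_erase hq)
  · rw [Finset.card_erase_of_mem hr] at this
    omega
  · intro p hp
    obtain ⟨hpr, hp⟩ := Finset.mem_erase.1 hp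
    obtain ⟨g, hg, hgo⟩ := hS p hp
    obtain ⟨h, hh, hho⟩ := hS r hr
    exact hno.exists_commutator_isOrb hG hg hh hgo hho (htop p hp).1 (htop p hp).2
      fun h => hpr (Prod.ext h.1.symm h.2)

lemma DepthLe.commutator {G : Subgroup (Equiv.Perm ℝ)} (hG : ∀ g ∈ G, PLHomeo g) {n : ℕ}
    (hn : DepthLe G (n + 1)) : DepthLe ⁅G, G⁆ n := by
  intro S hS hchain
  rcases S.eq_empty_or_nonempty with rfl | hne
  · simp
  obtain ⟨r, hr, hrmax⟩ := S.exists_max_image (fun p => p.2 - p.1) hne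
  have htop : ∀ p ∈ S, r.1 ≤ p.1 ∧ p.2 ≤ r.2 := by
    intro p hp
    have := hrmax p hp
    rcases hchain p hp r hr with h | h
    · exact h
    · constructor <;> linarith
  obtain ⟨f, hf, hfo⟩ := hS r hr
  obtain ⟨g, hg, a, b, hgo, ha, hb, hab⟩ := exists_larger_isOrb hG hf hfo
  have hlt : ∀ p ∈ S, a ≤ p.1 ∧ p.2 ≤ b := fun p hp =>
    ⟨ha.trans (htop p hp).1, (htop p hp).2.trans hb⟩
  have hnot : (a, b) ∉ S := fun h =>
    hab ⟨le_antisymm ha (htop _ h).1, le_antisymm (htop _ h).2 hb⟩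
  have := hn (insert (a, b) S) ?_ ?_
  · rw [Finset.card_insert_of_notMem hnot] at this
    omega
  · intro p hp
    rcases Finset.mem_insert.1 hp with rfl | hp
    · exact ⟨g, hg, hgo⟩
    · obtain ⟨u, hu, huo⟩ := hS p hp
      exact ⟨u, Subgroup.commutator_le_self G hu, huo⟩
  · intro p hp q hq
    rcases Finset.mem_insert.1 hp with rfl | hp <;> rcases Finset.mem_insert.1 hq with rfl | hq
    · exact Or.inl ⟨le_rfl, le_rfl⟩
    · exact Or.inr (hlt q hq)
    · exact Or.inl (hlt p hp)
    · exact hchain p hp q hq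

/-- The derived series of a subgroup, inside the ambient group. -/
lemma map_derivedSeries_eq_iterate {P : Type*} [Group P] (G : Subgroup P) (n : ℕ) :
    (derivedSeries G n).map G.subtype = (fun H : Subgroup P => ⁅H, H⁆)^[n] G := by
  induction n with
  | zero => simp [← MonoidHom.range_eq_map]
  | succ n ih =>
    rw [derivedSeries_succ, Subgroup.map_commutator, ih, Function.iterate_succ_apply']

lemma derivedSeries_eq_bot_iff {P : Type*} [Group P] (G : Subgroup P) (n : ℕ) :
    derivedSeries G n = ⊥ ↔ (fun H : Subgroup P => ⁅H, H⁆)^[n] G = ⊥ := by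
  rw [← map_derivedSeries_eq_iterate,
    Subgroup.map_eq_bot_iff_of_injective _ G.subtype_injective]

lemma depthLe_zero_iff {G : Subgroup (Equiv.Perm ℝ)} (hG : ∀ g ∈ G, PLHomeo g) :
    DepthLe G 0 ↔ G = ⊥ := by
  constructor
  · intro h
    refine (Subgroup.eq_bot_iff_forall G).2 fun g hg => ?_
    by_contra hne
    obtain ⟨x, hx⟩ : ∃ x, g x ≠ x := by
      by_contra! hcon
      exact hne (Equiv.ext hcon)
    obtain ⟨a, b, -, -, hab⟩ := exists_isOrb (hG g hg).1 hx
    have := h {(a, b)} (by simpa using ⟨g, hg, hab⟩) (by simp)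
    simp at this
  · rintro rfl S hS -
    rw [Nat.le_zero, Finset.card_eq_zero, Finset.eq_empty_iff_forall_notMem]
    intro p hp
    obtain ⟨g, hg, hgo⟩ := hS p hp
    obtain ⟨x, h1, h2⟩ := exists_between hgo.1
    rw [Subgroup.mem_bot] at hg
    exact hgo.2.2.2 x h1 h2 (by simp [hg])

lemma iterate_eq_bot_iff_depthLe (n : ℕ) : ∀ G : Subgroup (Equiv.Perm ℝ), (∀ g ∈ G, PLHomeo g) →
    ((fun H : Subgroup (Equiv.Perm ℝ) => ⁅H, H⁆)^[n] G = ⊥ ↔ DepthLe G n) ∧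
      (DepthLe G n → NoOverlap G) := by
  induction n with
  | zero =>
    intro G hG
    refine ⟨(depthLe_zero_iff hG).symm, fun h => ?_⟩
    rw [depthLe_zero_iff hG] at h
    subst h
    intro g hg h hh a₁ a₂ b₁ b₂ hgo
    obtain ⟨x, h1, h2⟩ := exists_between hgo.1
    rw [Subgroup.mem_bot] at hg
    exact absurd (by simp [hg]) (hgo.2.2.2 x h1 h2)
  | succ n ih =>
    intro G hG
    obtain ⟨ih1, ih2⟩ := ih ⁅G, G⁆ fun g hg => hG g (Subgroup.commutator_le_self G hg)
    have hno : DepthLe ⁅G, G⁆ n → NoOverlap G := fun h => .of_commutator hG h (ih2 h)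
    refine ⟨?_, fun h => hno (h.commutator hG)⟩
    rw [Function.iterate_succ_apply, ih1]
    exact ⟨fun h => h.succ hG (hno h), fun h => h.commutator hG⟩

lemma depthLe_of_isTower {G : Subgroup (Equiv.Perm ℝ)} (hG : ∀ g ∈ G, Homeo01 g) {n : ℕ}
    (hn : DepthLe G n) {T : Set (Set ℝ × Equiv.Perm ℝ)} (hT : IsTower G T) :
    T.Finite ∧ T.ncard ≤ n := by
  obtain ⟨h1, h2, h3⟩ := hT
  have key : ∀ F : Finset (Set ℝ × Equiv.Perm ℝ), (F : Set _) ⊆ T → F.card ≤ n := by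
    intro F hF
    have horb : ∀ t ∈ F, ∃ a b, IsOrb t.2 a b ∧ t.1 = Set.Ioo a b := fun t ht =>
      (isOrbital_iff (hG _ (h1 t (hF ht)).1)).1 (h1 t (hF ht)).2
    have hends : ∀ t ∈ F, IsOrb t.2 (sInf t.1) (sSup t.1) ∧ t.1 = Set.Ioo (sInf t.1) (sSup t.1) := by
      intro t ht
      obtain ⟨a, b, hab, heq⟩ := horb t ht
      rw [heq, csInf_Ioo hab.1, csSup_Ioo hab.1]
      exact ⟨hab, rfl⟩
    have hinj : Set.InjOn (fun t : Set ℝ × Equiv.Perm ℝ => (sInf t.1, sSup t.1)) F := by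
      intro t ht t' ht' heq
      obtain ⟨e1, e2⟩ := Prod.ext_iff.1 heq
      refine h3 t (hF ht) t' (hF ht') ?_
      rw [(hends t ht).2, (hends t' ht').2]
      simp only at e1 e2
      rw [e1, e2]
    rw [← Finset.card_image_of_injOn hinj]
    refine hn _ ?_ ?_
    · intro p hp
      obtain ⟨t, ht, rfl⟩ := Finset.mem_image.1 hp
      exact ⟨t.2, (h1 t (hF ht)).1, (hends t ht).1⟩
    · intro p hp q hq
      obtain ⟨t, ht, rfl⟩ := Finset.mem_image.1 hp
      obtain ⟨t', ht', rfl⟩ := Finset.mem_image.1 hq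
      refine (h2 t (hF ht) t' (hF ht')).imp (fun h => ?_) fun h => ?_
      · rw [(hends t ht).2, (hends t' ht').2] at h
        exact (Set.Ioo_subset_Ioo_iff (hends t ht).1.1).1 h
      · rw [(hends t ht).2, (hends t' ht').2] at h
        exact (Set.Ioo_subset_Ioo_iff (hends t' ht').1.1).1 h
  have hfin : T.Finite := by
    by_contra hinf
    obtain ⟨F, hF, hcard⟩ := Set.Infinite.exists_subset_card_eq hinf (n + 1)
    have := key F hF
    omega
  refine ⟨hfin, ?_⟩
  rw [Set.ncard_eq_toFinset_card T hfin]
  exact key _ (by simp)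

lemma exists_isTower {G : Subgroup (Equiv.Perm ℝ)} (hG : ∀ g ∈ G, Homeo01 g)
    {S : Finset (ℝ × ℝ)} (hS : ∀ p ∈ S, ∃ g ∈ G, IsOrb g p.1 p.2)
    (hchain : ∀ p ∈ S, ∀ q ∈ S, (q.1 ≤ p.1 ∧ p.2 ≤ q.2) ∨ (p.1 ≤ q.1 ∧ q.2 ≤ p.2)) :
    ∃ T, IsTower G T ∧ T.Finite ∧ T.ncard = S.card := by
  choose! σ hσG hσ using hS
  have hinj : ∀ p ∈ S, ∀ q ∈ S, Set.Ioo p.1 p.2 = Set.Ioo q.1 q.2 → p = q := by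
    intro p hp q hq h
    have h1 := congrArg sInf h
    have h2 := congrArg sSup h
    rw [csInf_Ioo (hσ p hp).1, csInf_Ioo (hσ q hq).1] at h1
    rw [csSup_Ioo (hσ p hp).1, csSup_Ioo (hσ q hq).1] at h2
    exact Prod.ext h1 h2
  refine ⟨(fun p => (Set.Ioo p.1 p.2, σ p)) '' S, ⟨?_, ?_, ?_⟩, S.finite_toSet.image _, ?_⟩
  · rintro _ ⟨p, hp, rfl⟩
    exact ⟨hσG p hp, (isOrbital_iff (hG _ (hσG p hp))).2 ⟨_, _, hσ p hp, rfl⟩⟩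
  · rintro _ ⟨p, hp, rfl⟩ _ ⟨q, hq, rfl⟩
    exact (hchain p hp q hq).imp (fun h => Set.Ioo_subset_Ioo h.1 h.2)
      fun h => Set.Ioo_subset_Ioo h.1 h.2
  · rintro _ ⟨p, hp, rfl⟩ _ ⟨q, hq, rfl⟩ h
    rw [hinj p hp q hq h]
  · rw [Set.InjOn.ncard_image fun p hp q hq h => hinj p hp q hq (Prod.ext_iff.1 h).1,
      Set.ncard_coe_finset]

lemma depthEq_iff {G : Subgroup (Equiv.Perm ℝ)} (hG : ∀ g ∈ G, Homeo01 g) (n : ℕ) :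
    DepthEq G n ↔ DepthLe G n ∧ ∀ m < n, ¬ DepthLe G m := by
  constructor
  · rintro ⟨⟨T, hT, -, hcard⟩, hle⟩
    refine ⟨fun S hS hchain => ?_, fun m hm h => ?_⟩
    · obtain ⟨T', hT', -, hcard'⟩ := exists_isTower hG hS hchain
      exact hcard' ▸ (hle T' hT').2
    · have := (depthLe_of_isTower hG h hT).2
      omega
  · rintro ⟨hle, hlt⟩
    refine ⟨?_, fun T hT => depthLe_of_isTower hG hle hT⟩
    obtain ⟨S, hS, hchain, hcard⟩ : ∃ S : Finset (ℝ × ℝ), (∀ p ∈ S, ∃ g ∈ G, IsOrb g p.1 p.2) ∧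
        (∀ p ∈ S, ∀ q ∈ S, (q.1 ≤ p.1 ∧ p.2 ≤ q.2) ∨ (p.1 ≤ q.1 ∧ q.2 ≤ p.2)) ∧ n ≤ S.card := by
      rcases n with - | m
      · exact ⟨∅, by simp, by simp, by simp⟩
      · by_contra! hcon
        exact hlt m m.lt_succ_self fun S hS hchain => Nat.lt_succ_iff.1 (hcon S hS hchain)
    have heq : S.card = n := le_antisymm (hle S hS hchain) hcard
    exact heq ▸ exists_isTower hG hS hchain

end PLTower

theorem stmt12 (G : Subgroup (Equiv.Perm ℝ)) (hG : ∀ g ∈ G, PLHomeo g) (n : ℕ) :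
    (derivedSeries (↥G) n = ⊥ ∧ ∀ m < n, derivedSeries (↥G) m ≠ ⊥) ↔ DepthEq G n := by
  have h : ∀ m, derivedSeries (↥G) m = ⊥ ↔ PLTower.DepthLe G m := fun m =>
    (PLTower.derivedSeries_eq_bot_iff G m).trans (PLTower.iterate_eq_bot_iff_depthLe m G hG).1
  simp only [ne_eq, h, PLTower.depthEq_iff (fun g hg => (hG g hg).1)]
end
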